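/- For every real number M there exists a plane triangulation G such that s_{K4}(G) − s_o(G) > M; that is, the difference between the maximum order of an induced K4-minor-free subgraph and the maximum order of an induced outerplanar subgraph is unbounded over plane triangulations. -/

import Mathlib

/-- A drawing (embedding) of a simple graph in the plane `ℝ × ℝ` without crossings:
vertices are mapped to distinct points, each edge to an injective arc joining its
endpoints, arcs pass through no other vertex, and two arcs of distinct edges meet
only in common endpoints. -/
structure PlaneEmbedding {V : Type} (G : SimpleGraph V) where
  vtx : V → ℝ × ℝ
  vtx_inj : Function.Injective vtx
  arc : ∀ ⦃u v : V⦄, G.Adj u v → Set (ℝ × ℝ)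
  arc_symm : ∀ ⦃u v : V⦄ (h : G.Adj u v), arc h.symm = arc h
  arc_path : ∀ ⦃u v : V⦄ (h : G.Adj u v),
    ∃ γ : Path (vtx u) (vtx v), Function.Injective ⇑γ ∧ Set.range ⇑γ = arc h
  arc_vtx : ∀ ⦃u v : V⦄ (h : G.Adj u v) (w : V), vtx w ∈ arc h → w = u ∨ w = v
  arc_inter : ∀ ⦃u v a b : V⦄ (h₁ : G.Adj u v) (h₂ : G.Adj a b), s(u, v) ≠ s(a, b) →
    arc h₁ ∩ arc h₂ ⊆ ({vtx u, vtx v} : Set (ℝ × ℝ)) ∩ {vtx a, vtx b}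

namespace PlaneEmbedding

variable {V : Type} {G : SimpleGraph V}

/-- The point set of the sub-drawing determined by the vertices in `S`
(the inherited embedding of the induced subgraph on `S`). -/
def subSupport (E : PlaneEmbedding G) (S : Set V) : Set (ℝ × ℝ) :=
  E.vtx '' S ∪ ⋃ (u : V) (_ : u ∈ S) (v : V) (_ : v ∈ S) (h : G.Adj u v), E.arc h

/-- The induced subgraph on `S`, with the inherited embedding, is an outerplane graph:
every vertex of `S` lies on the boundary of the outer (unbounded) face, i.e. in the
closure of the set of points belonging to unbounded faces of the sub-drawing. -/
def OuterplaneOn (E : PlaneEmbedding G) (S : Set V) : Prop :=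
  ∀ v ∈ S, E.vtx v ∈ closure {p | p ∉ E.subSupport S ∧
    ¬ Bornology.IsBounded (connectedComponentIn (E.subSupport S)ᶜ p)}

/-- The whole drawing is an outerplane graph. -/
def IsOuterplane (E : PlaneEmbedding G) : Prop := E.OuterplaneOn Set.univ

end PlaneEmbedding

/-- A graph is planar if it admits a plane embedding. -/
def IsPlanar {V : Type} (G : SimpleGraph V) : Prop := Nonempty (PlaneEmbedding G)

/-- A graph is outerplanar if it admits a plane embedding with all vertices on the
boundary of the outer face. -/
def IsOuterplanar {V : Type} (G : SimpleGraph V) : Prop :=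
  ∃ E : PlaneEmbedding G, E.IsOuterplane

/-- A plane triangulation is an edge-maximal (finite) planar graph. -/
def IsPlaneTriangulation {V : Type} (G : SimpleGraph V) : Prop :=
  IsPlanar G ∧ ∀ u v : V, u ≠ v → ¬ G.Adj u v →
    ¬ IsPlanar (G ⊔ SimpleGraph.fromEdgeSet {s(u, v)})

/-- `G` has a `K_m`-minor: there are `m` pairwise disjoint nonempty connected branch
sets with an edge between any two of them. -/
def HasCliqueMinor {V : Type} (G : SimpleGraph V) (m : ℕ) : Prop :=
  ∃ B : Fin m → Set V,
    (∀ i, (B i).Nonempty) ∧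
    (∀ i, (G.induce (B i)).Connected) ∧
    (∀ i j, i ≠ j → Disjoint (B i) (B j)) ∧
    (∀ i j, i ≠ j → ∃ u ∈ B i, ∃ v ∈ B j, G.Adj u v)

/-- `G` is `K₄`-minor free. -/
def K4MinorFree {V : Type} (G : SimpleGraph V) : Prop := ¬ HasCliqueMinor G 4

/-- `s_{o'}(G)` for a fixed plane embedding of `G`: the maximum order of an induced
subgraph whose inherited embedding is an outerplane graph. -/
noncomputable def sO' {V : Type} [Fintype V] {G : SimpleGraph V}
    (E : PlaneEmbedding G) : ℕ :=
  sSup {n | ∃ S : Finset V, E.OuterplaneOn ↑S ∧ S.card = n}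

/-- `s_o(G)`: the maximum order of an induced outerplanar subgraph of `G`. -/
noncomputable def sO {V : Type} [Fintype V] (G : SimpleGraph V) : ℕ :=
  sSup {n | ∃ S : Finset V, IsOuterplanar (G.induce (↑S : Set V)) ∧ S.card = n}

/-- `s_{K₄}(G)`: the maximum order of an induced `K₄`-minor-free subgraph of `G`. -/
noncomputable def sK4 {V : Type} [Fintype V] (G : SimpleGraph V) : ℕ :=
  sSup {n | ∃ S : Finset V, K4MinorFree (G.induce (↑S : Set V)) ∧ S.card = n}

/-- `tw(G) ≤ k`: `G` admits a tree decomposition of width at most `k`. -/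
def TreewidthLE {V : Type} (G : SimpleGraph V) (k : ℕ) : Prop :=
  ∃ (ι : Type) (T : SimpleGraph ι) (bag : ι → Set V),
    T.IsTree ∧
    (∀ v : V, ∃ i, v ∈ bag i) ∧
    (∀ u v : V, G.Adj u v → ∃ i, u ∈ bag i ∧ v ∈ bag i) ∧
    (∀ v : V, (T.induce {i | v ∈ bag i}).Connected) ∧
    (∀ i, (bag i).ncard ≤ k + 1)

/-- `G` is a `k`-tree: its vertices admit a construction order in which the first
`k+1` vertices form a complete graph and every later vertex is joined to exactly
`k` earlier, pairwise adjacent, vertices. -/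
def IsKTree (k : ℕ) {V : Type} (G : SimpleGraph V) : Prop :=
  ∃ (n : ℕ) (e : Fin n ≃ V), k + 1 ≤ n ∧
    (∀ i j : Fin n, (i : ℕ) < k + 1 → (j : ℕ) < k + 1 → i ≠ j → G.Adj (e i) (e j)) ∧
    (∀ j : Fin n, k + 1 ≤ (j : ℕ) →
      {i : Fin n | i < j ∧ G.Adj (e i) (e j)}.ncard = k ∧
      (∀ i i' : Fin n, i < j → i' < j → G.Adj (e i) (e j) → G.Adj (e i') (e j) →
        i ≠ i' → G.Adj (e i) (e i')))

/-- `S` is a dominating set of `G`. -/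
def IsDomSet {V : Type} (G : SimpleGraph V) (S : Set V) : Prop :=
  ∀ v : V, v ∈ S ∨ ∃ u ∈ S, G.Adj u v

/-- `S` is a connected dominating set of `G`. -/
def IsConnDomSet {V : Type} (G : SimpleGraph V) (S : Set V) : Prop :=
  IsDomSet G S ∧ (G.induce S).Connected

/-- The domination number `γ(G)`. -/
noncomputable def domNum {V : Type} [Fintype V] (G : SimpleGraph V) : ℕ :=
  sInf {n | ∃ S : Finset V, IsDomSet G ↑S ∧ S.card = n}

/-- The connected domination number `γ_c(G)`. -/
noncomputable def connDomNum {V : Type} [Fintype V] (G : SimpleGraph V) : ℕ :=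
  sInf {n | ∃ S : Finset V, IsConnDomSet G ↑S ∧ S.card = n}

/-- A graph is Eulerian if every vertex has even degree. -/
def IsEulerian {V : Type} (G : SimpleGraph V) : Prop :=
  ∀ v : V, Even (G.neighborSet v).ncard

/-- `G` contains a subgraph isomorphic to `H`. -/
def ContainsCopy {W V : Type} (H : SimpleGraph W) (G : SimpleGraph V) : Prop :=
  ∃ f : H →g G, Function.Injective ⇑f

/-- The complete tripartite graph `K_{1,1,3}`. -/
def K113 : SimpleGraph (Fin 5) :=
  SimpleGraph.fromEdgeSet {s(0, 1), s(0, 2), s(0, 3), s(0, 4), s(1, 2), s(1, 3), s(1, 4)}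

/-- `G` is a maximal outerplanar graph. -/
def IsMaximalOuterplanar {V : Type} (G : SimpleGraph V) : Prop :=
  IsOuterplanar G ∧ ∀ u v : V, u ≠ v → ¬ G.Adj u v →
    ¬ IsOuterplanar (G ⊔ SimpleGraph.fromEdgeSet {s(u, v)})

/-! ### Angle changes along paths and weak drawings of `K₅` and `K₃,₃` -/

section Winding

open unitInterval Complex

/-- A continuous nowhere vanishing function on a simply connected space has a continuous
logarithm. -/
theorem exists_continuous_log {A : Type} [TopologicalSpace A] [SimplyConnectedSpace A]
    [LocallyPathConnectedSpace A] (f : C(A, ℂ)) (hf : ∀ a, f a ≠ 0) (a₀ : A) :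
    ∃ F : C(A, ℂ), ∀ a, exp (F a) = f a := by
  obtain ⟨F, ⟨-, hF⟩, -⟩ := isCoveringMapOn_exp.existsUnique_continuousMap_lifts f
    (a₀ := a₀) (e₀ := log (f a₀)) (exp_log (hf a₀)) (fun a => by simpa using hf a)
  exact ⟨F, fun a => congrFun hF a⟩

theorem contractibleSpace_unitInterval : ContractibleSpace I :=
  (convex_Icc (0 : ℝ) 1).contractibleSpace ⟨0, by simp⟩

theorem locallyPathConnectedSpace_unitInterval : LocallyPathConnectedSpace I :=
  (isQuotientMap_projIcc (h := zero_le_one' ℝ)).locallyPathConnectedSpace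

open Classical in
/-- The change of `log (γ s - v)` along the curve `γ`. -/
noncomputable def logChange (γ : I → ℂ) (v : ℂ) : ℂ :=
  if h : ∃ L : C(I, ℂ), ∀ s, exp (L s) = γ s - v then h.choose 1 - h.choose 0 else 0

theorem logChange_eq {γ : I → ℂ} {v : ℂ} (L : C(I, ℂ)) (hL : ∀ s, exp (L s) = γ s - v) :
    logChange γ v = L 1 - L 0 := by
  have := contractibleSpace_unitInterval
  have := locallyPathConnectedSpace_unitInterval
  have h : ∃ L : C(I, ℂ), ∀ s, exp (L s) = γ s - v := ⟨L, hL⟩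
  rw [logChange, dif_pos h]
  set L' := h.choose with hL'
  have hs : ∀ s, exp (L' s) = γ s - v := h.choose_spec
  have hne : ∀ s, γ s - v ≠ 0 := fun s => hL s ▸ exp_ne_zero _
  have hc : Continuous γ := by
    have : γ = fun s => exp (L s) + v := by ext s; rw [hL]; ring
    rw [this]; fun_prop
  obtain ⟨F, -, hF⟩ := isCoveringMapOn_exp.existsUnique_continuousMap_lifts
    (⟨fun s => γ s - v, by fun_prop⟩ : C(I, ℂ)) (a₀ := 0) (e₀ := L 0) (hL 0)
    (fun a => by simpa using hne a)
  have h₁ := hF L ⟨rfl, funext hL⟩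
  have h₂ := hF (L' + ContinuousMap.const _ (L 0 - L' 0)) ⟨by simp, by
    funext s
    have h0 : exp (L 0 - L' 0) = 1 := by
      rw [exp_sub, hL, hs, div_self (hne 0)]
    simp [exp_add, hs, h0]⟩
  have h₃ : L 1 = L' 1 + (L 0 - L' 0) := by
    conv_lhs => rw [h₁, ← h₂]
    simp
  rw [h₃]; ring

/-- For disjoint curves, the four changes of logarithm around the boundary of the square
of pairs of parameters add up to zero. -/
theorem logChange_square (γ δ : C(I, ℂ)) (h : ∀ s t, γ s ≠ δ t) :
    logChange γ (δ 0) - logChange γ (δ 1) + logChange δ (γ 1) - logChange δ (γ 0) = 0 := by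
  have := contractibleSpace_unitInterval
  have := locallyPathConnectedSpace_unitInterval
  obtain ⟨F, hF⟩ := exists_continuous_log
    (⟨fun x : I × I => γ x.1 - δ x.2, by fun_prop⟩ : C(I × I, ℂ))
    (fun x => sub_ne_zero.2 (h _ _)) (0, 0)
  have hγ : ∀ t, logChange γ (δ t) = F (1, t) - F (0, t) := fun t =>
    logChange_eq (⟨fun s => F (s, t), by fun_prop⟩ : C(I, ℂ)) (fun s => hF (s, t))
  have hδ : ∀ s, logChange δ (γ s) = F (s, 1) - F (s, 0) := fun s => by
    rw [logChange_eq (⟨fun t => F (s, t) + Real.pi * Complex.I, by fun_prop⟩ : C(I, ℂ))]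
    · simp
    · intro t
      have := hF (s, t)
      simp only [ContinuousMap.coe_mk] at this ⊢
      rw [exp_add, this, exp_pi_mul_I]; ring
  rw [hγ, hγ, hδ, hδ]; ring

theorem exp_logChange {γ : C(I, ℂ)} {v : ℂ} (h : ∀ s, γ s ≠ v) :
    exp (logChange γ v) = (γ 1 - v) / (γ 0 - v) := by
  have := contractibleSpace_unitInterval
  have := locallyPathConnectedSpace_unitInterval
  obtain ⟨F, hF⟩ := exists_continuous_log (⟨fun s => γ s - v, by fun_prop⟩ : C(I, ℂ))
    (fun x => sub_ne_zero.2 (h _)) 0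
  rw [logChange_eq F hF, exp_sub, hF, hF]; rfl

/-- The parity relation between independent edges of a weak drawing: the integers `N a b c`
measure the winding of the edge `a b` around the vertex `c`. -/
theorem exists_winding_integers {ι : Type} [LinearOrder ι] (p : ι → ℂ)
    (hp : Function.Injective p) (R : ι → ι → Prop) (A : ι → ι → Set ℂ)
    (hA : ∀ i j, R i j → JoinedIn (A i j) (p i) (p j))
    (hd : ∀ a b c d, R a b → R c d → a ≠ c → a ≠ d → b ≠ c → b ≠ d →
      Disjoint (A a b) (A c d)) :
    ∃ N : ι → ι → ι → ℤ, ∀ a b c d, R a b → R c d → a ≠ c → a ≠ d → b ≠ c → b ≠ d →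
      2 * (N a b c - N a b d + N c d b - N c d a) + (if b < c then -1 else 1) +
        (if c < a then -1 else 1) + (if d < b then -1 else 1) +
        (if a < d then -1 else 1) = 0 := by
  classical
  choose γ hγ using hA
  let ang : ι → ι → ℂ := fun i j =>
    if i < j then log (p i - p j) else log (p j - p i) + Real.pi * Complex.I
  have hang : ∀ i j, i ≠ j → exp (ang i j) = p i - p j := by
    intro i j hij
    have h1 : p i - p j ≠ 0 := sub_ne_zero.2 (hp.ne hij)
    have h2 : p j - p i ≠ 0 := sub_ne_zero.2 (hp.ne hij.symm)
    by_cases h : i < j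
    · simp only [ang, if_pos h, exp_log h1]
    · simp only [ang, if_neg h, exp_add, exp_log h2, exp_pi_mul_I]; ring
  have hswap : ∀ i j, i ≠ j →
      ang i j - ang j i = (if i < j then -1 else 1 : ℤ) * (Real.pi * Complex.I) := by
    intro i j hij
    rcases lt_or_gt_of_ne hij with h | h
    · simp only [ang, if_pos h, if_neg h.asymm]; push_cast; ring
    · simp only [ang, if_pos h, if_neg h.asymm]; push_cast; ring
  have key : ∀ a b c, ∃ n : ℤ, ∀ h : R a b, a ≠ c → b ≠ c → (∀ s, γ a b h s ≠ p c) →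
      logChange (γ a b h) (p c) = ang b c - ang a c + n * (2 * Real.pi * Complex.I) := by
    intro a b c
    by_cases h : R a b ∧ a ≠ c ∧ b ≠ c
    · obtain ⟨h, hac, hbc⟩ := h
      by_cases hs : ∀ s, γ a b h s ≠ p c
      · have h1 : exp (logChange (γ a b h) (p c)) = exp (ang b c - ang a c) := by
          have := exp_logChange (γ := (γ a b h : C(I, ℂ))) (v := p c) hs
          rw [exp_sub, hang b c hbc, hang a c hac]
          simpa using this
        obtain ⟨n, hn⟩ := exp_eq_exp_iff_exists_int.1 h1
        exact ⟨n, fun _ _ _ _ => hn⟩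
      · exact ⟨0, fun _ _ _ h' => absurd h' hs⟩
    · exact ⟨0, fun h1 h2 h3 => absurd ⟨h1, h2, h3⟩ h⟩
  choose N hN using key
  refine ⟨N, fun a b c d hab hcd hac had hbc hbd => ?_⟩
  have hdis := hd a b c d hab hcd hac had hbc hbd
  have hne : ∀ s t, γ a b hab s ≠ γ c d hcd t := fun s t h =>
    Set.disjoint_left.1 hdis (hγ a b hab s) (h ▸ hγ c d hcd t)
  have hsq := logChange_square (γ a b hab : C(I, ℂ)) (γ c d hcd : C(I, ℂ)) hne
  have e1 := hN a b c hab hac hbc (fun s => by simpa using hne s 0)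
  have e2 := hN a b d hab had hbd (fun s => by simpa using hne s 1)
  have e3 := hN c d b hcd hbc.symm hbd.symm (fun s => by simpa using (hne 1 s).symm)
  have e4 := hN c d a hcd hac.symm had.symm (fun s => by simpa using (hne 0 s).symm)
  have hsq' : logChange (γ a b hab) (p c) - logChange (γ a b hab) (p d) +
      logChange (γ c d hcd) (p b) - logChange (γ c d hcd) (p a) = 0 := by
    simpa using hsq
  rw [e1, e2, e3, e4] at hsq'
  have s1 := hswap b c hbc
  have s2 := hswap c a hac.symm
  have s3 := hswap d b hbd.symm
  have s4 := hswap a d had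
  generalize (if b < c then -1 else 1 : ℤ) = w1 at *
  generalize (if c < a then -1 else 1 : ℤ) = w2 at *
  generalize (if d < b then -1 else 1 : ℤ) = w3 at *
  generalize (if a < d then -1 else 1 : ℤ) = w4 at *
  have hpi : (Real.pi * Complex.I : ℂ) ≠ 0 :=
    mul_ne_zero (by exact_mod_cast Real.pi_ne_zero) I_ne_zero
  have : ((2 * (N a b c - N a b d + N c d b - N c d a) + w1 + w2 + w3 + w4 : ℤ) : ℂ) = 0 := by
    apply mul_right_cancel₀ hpi
    push_cast
    linear_combination hsq' - s1 - s2 - s3 - s4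
  exact_mod_cast this

/-- The plane as the complex numbers. -/
theorem JoinedIn.toComplex {S : Set (ℝ × ℝ)} {x y : ℝ × ℝ} (h : JoinedIn S x y) :
    JoinedIn (equivRealProdCLM.symm '' S) (equivRealProdCLM.symm x)
      (equivRealProdCLM.symm y) := by
  obtain ⟨γ, hγ⟩ := h
  exact ⟨γ.map equivRealProdCLM.symm.continuous, fun t => ⟨γ t, hγ t, rfl⟩⟩

theorem exists_winding_integers_plane {ι : Type} [LinearOrder ι] (p : ι → ℝ × ℝ)
    (hp : Function.Injective p) (R : ι → ι → Prop) (A : ι → ι → Set (ℝ × ℝ))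
    (hA : ∀ i j, R i j → JoinedIn (A i j) (p i) (p j))
    (hd : ∀ a b c d, R a b → R c d → a ≠ c → a ≠ d → b ≠ c → b ≠ d →
      Disjoint (A a b) (A c d)) :
    ∃ N : ι → ι → ι → ℤ, ∀ a b c d, R a b → R c d → a ≠ c → a ≠ d → b ≠ c → b ≠ d →
      2 * (N a b c - N a b d + N c d b - N c d a) + (if b < c then -1 else 1) +
        (if c < a then -1 else 1) + (if d < b then -1 else 1) +
        (if a < d then -1 else 1) = 0 :=
  exists_winding_integers (fun i => equivRealProdCLM.symm (p i))
    (equivRealProdCLM.symm.injective.comp hp) R (fun i j => equivRealProdCLM.symm '' A i j)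
    (fun i j h => (hA i j h).toComplex)
    (fun a b c d h1 h2 h3 h4 h5 h6 =>
      (Set.disjoint_image_iff equivRealProdCLM.symm.injective).2 (hd a b c d h1 h2 h3 h4 h5 h6))

/-- `K₅` has no drawing in which independent edges are disjoint. -/
theorem not_weak_drawing_K5 (p : Fin 5 → ℝ × ℝ) (hp : Function.Injective p)
    (A : Fin 5 → Fin 5 → Set (ℝ × ℝ))
    (hA : ∀ i j, i < j → JoinedIn (A i j) (p i) (p j))
    (hd : ∀ a b c d, a < b → c < d → a < c → b ≠ c → b ≠ d →
      Disjoint (A a b) (A c d)) : False := by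
  obtain ⟨N, hN⟩ := exists_winding_integers_plane p hp (· < ·) A hA
    (fun a b c d h1 h2 h3 h4 h5 h6 => by
      rcases lt_or_gt_of_ne h3 with h | h
      · exact hd a b c d h1 h2 h h5 h6
      · exact (hd c d a b h2 h1 h h4.symm h6.symm).symm)
  have e1 := hN 0 1 2 3 (by decide) (by decide) (by decide) (by decide) (by decide) (by decide)
  have e2 := hN 0 1 2 4 (by decide) (by decide) (by decide) (by decide) (by decide) (by decide)
  have e3 := hN 0 1 3 4 (by decide) (by decide) (by decide) (by decide) (by decide) (by decide)
  have e4 := hN 0 2 1 3 (by decide) (by decide) (by decide) (by decide) (by decide) (by decide)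
  have e5 := hN 0 2 1 4 (by decide) (by decide) (by decide) (by decide) (by decide) (by decide)
  have e6 := hN 0 2 3 4 (by decide) (by decide) (by decide) (by decide) (by decide) (by decide)
  have e7 := hN 0 3 1 2 (by decide) (by decide) (by decide) (by decide) (by decide) (by decide)
  have e8 := hN 0 3 1 4 (by decide) (by decide) (by decide) (by decide) (by decide) (by decide)
  have e9 := hN 0 3 2 4 (by decide) (by decide) (by decide) (by decide) (by decide) (by decide)
  have e10 := hN 0 4 1 2 (by decide) (by decide) (by decide) (by decide) (by decide) (by decide)
  have e11 := hN 0 4 1 3 (by decide) (by decide) (by decide) (by decide) (by decide) (by decide)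
  have e12 := hN 0 4 2 3 (by decide) (by decide) (by decide) (by decide) (by decide) (by decide)
  have e13 := hN 1 2 3 4 (by decide) (by decide) (by decide) (by decide) (by decide) (by decide)
  have e14 := hN 1 3 2 4 (by decide) (by decide) (by decide) (by decide) (by decide) (by decide)
  have e15 := hN 1 4 2 3 (by decide) (by decide) (by decide) (by decide) (by decide) (by decide)
  simp only [Fin.reduceLT, if_true, if_false] at e1 e2 e3 e4 e5 e6 e7 e8 e9 e10 e11 e12 e13 e14 e15
  omega

/-- `K₃,₃`, with parts the even and the odd numbers below `6`, has no drawing in which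
independent edges are disjoint. -/
theorem not_weak_drawing_K33 (p : Fin 6 → ℝ × ℝ) (hp : Function.Injective p)
    (A : Fin 6 → Fin 6 → Set (ℝ × ℝ))
    (hA : ∀ i j : Fin 6, i.val % 2 = 0 → j.val % 2 = 1 → JoinedIn (A i j) (p i) (p j))
    (hd : ∀ a b c d : Fin 6, a.val % 2 = 0 → b.val % 2 = 1 → c.val % 2 = 0 → d.val % 2 = 1 →
      a < c → b ≠ d → Disjoint (A a b) (A c d)) : False := by
  obtain ⟨N, hN⟩ := exists_winding_integers_plane p hp
    (fun i j => i.val % 2 = 0 ∧ j.val % 2 = 1) A (fun i j h => hA i j h.1 h.2)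
    (fun a b c d h1 h2 h3 h4 h5 h6 => by
      rcases lt_or_gt_of_ne h3 with h | h
      · exact hd a b c d h1.1 h1.2 h2.1 h2.2 h h6
      · exact (hd c d a b h2.1 h2.2 h1.1 h1.2 h h6.symm).symm)
  have key : ∀ a b c d : Fin 6, a.val % 2 = 0 → b.val % 2 = 1 → c.val % 2 = 0 →
      d.val % 2 = 1 → a ≠ c → b ≠ d → _ := fun a b c d h1 h2 h3 h4 h5 h6 =>
    hN a b c d ⟨h1, h2⟩ ⟨h3, h4⟩ h5 (by rintro rfl; omega) (by rintro rfl; omega) h6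
  have e1 := key 0 1 2 3 (by decide) (by decide) (by decide) (by decide) (by decide) (by decide)
  have e2 := key 0 1 2 5 (by decide) (by decide) (by decide) (by decide) (by decide) (by decide)
  have e3 := key 0 3 2 1 (by decide) (by decide) (by decide) (by decide) (by decide) (by decide)
  have e4 := key 0 3 2 5 (by decide) (by decide) (by decide) (by decide) (by decide) (by decide)
  have e5 := key 0 5 2 1 (by decide) (by decide) (by decide) (by decide) (by decide) (by decide)
  have e6 := key 0 5 2 3 (by decide) (by decide) (by decide) (by decide) (by decide) (by decide)
  have e7 := key 0 1 4 3 (by decide) (by decide) (by decide) (by decide) (by decide) (by decide)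
  have e8 := key 0 1 4 5 (by decide) (by decide) (by decide) (by decide) (by decide) (by decide)
  have e9 := key 0 3 4 1 (by decide) (by decide) (by decide) (by decide) (by decide) (by decide)
  have e10 := key 0 3 4 5 (by decide) (by decide) (by decide) (by decide) (by decide) (by decide)
  have e11 := key 0 5 4 1 (by decide) (by decide) (by decide) (by decide) (by decide) (by decide)
  have e12 := key 0 5 4 3 (by decide) (by decide) (by decide) (by decide) (by decide) (by decide)
  have e13 := key 2 1 4 3 (by decide) (by decide) (by decide) (by decide) (by decide) (by decide)
  have e14 := key 2 1 4 5 (by decide) (by decide) (by decide) (by decide) (by decide) (by decide)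
  have e15 := key 2 3 4 1 (by decide) (by decide) (by decide) (by decide) (by decide) (by decide)
  have e16 := key 2 3 4 5 (by decide) (by decide) (by decide) (by decide) (by decide) (by decide)
  have e17 := key 2 5 4 1 (by decide) (by decide) (by decide) (by decide) (by decide) (by decide)
  have e18 := key 2 5 4 3 (by decide) (by decide) (by decide) (by decide) (by decide) (by decide)
  simp only [Fin.reduceLT, if_true, if_false] at e1 e2 e3 e4 e5 e6 e7 e8 e9 e10 e11 e12 e13 e14 e15 e16 e17 e18
  omega

end Winding

/-! ### Obstructions to planarity and outerplanarity -/

namespace PlaneEmbedding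

variable {V : Type} {G : SimpleGraph V}

theorem vtx_mem_subSupport (E : PlaneEmbedding G) {S : Set V} {v : V} (h : v ∈ S) :
    E.vtx v ∈ E.subSupport S := Or.inl ⟨v, h, rfl⟩

theorem arc_subset_subSupport (E : PlaneEmbedding G) {S : Set V} {u v : V} (h : G.Adj u v)
    (hu : u ∈ S) (hv : v ∈ S) : E.arc h ⊆ E.subSupport S := fun _ hx =>
  Or.inr (Set.mem_iUnion.2 ⟨u, Set.mem_iUnion.2 ⟨hu, Set.mem_iUnion.2 ⟨v, Set.mem_iUnion.2
    ⟨hv, Set.mem_iUnion.2 ⟨h, hx⟩⟩⟩⟩⟩)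

theorem mem_subSupport_iff (E : PlaneEmbedding G) {S : Set V} {x : ℝ × ℝ} :
    x ∈ E.subSupport S ↔ (∃ v ∈ S, E.vtx v = x) ∨
      ∃ u ∈ S, ∃ v ∈ S, ∃ h : G.Adj u v, x ∈ E.arc h := by
  simp [subSupport]

theorem subSupport_mono (E : PlaneEmbedding G) {S T : Set V} (h : S ⊆ T) :
    E.subSupport S ⊆ E.subSupport T := by
  intro x hx
  rw [mem_subSupport_iff] at hx ⊢
  rcases hx with ⟨v, hv, hx⟩ | ⟨u, hu, v, hv, ha, hx⟩
  · exact Or.inl ⟨v, h hv, hx⟩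
  · exact Or.inr ⟨u, h hu, v, h hv, ha, hx⟩

theorem disjoint_subSupport (E : PlaneEmbedding G) {S T : Set V} (h : Disjoint S T) :
    Disjoint (E.subSupport S) (E.subSupport T) := by
  have hne : ∀ {a b}, a ∈ S → b ∈ T → a ≠ b := fun ha hb => Set.disjoint_iff_forall_ne.1 h ha hb
  rw [Set.disjoint_left]
  intro x hx hy
  rw [mem_subSupport_iff] at hx hy
  rcases hx with ⟨v, hv, rfl⟩ | ⟨u, hu, v, hv, ha, hx⟩
  · rcases hy with ⟨w, hw, hx⟩ | ⟨u, hu, w, hw, ha, hx⟩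
    · exact hne hv hw (E.vtx_inj hx).symm
    · rcases E.arc_vtx ha v hx with rfl | rfl
      · exact hne hv hu rfl
      · exact hne hv hw rfl
  · rcases hy with ⟨w, hw, rfl⟩ | ⟨u', hu', w, hw, ha', hx'⟩
    · rcases E.arc_vtx ha w hx with rfl | rfl
      · exact hne hu hw rfl
      · exact hne hv hw rfl
    · have hs : s(u, v) ≠ s(u', w) := by
        intro hs
        rcases Sym2.eq_iff.1 hs with ⟨rfl, -⟩ | ⟨rfl, -⟩
        · exact hne hu hu' rfl
        · exact hne hu hw rfl
      have := E.arc_inter ha ha' hs ⟨hx, hx'⟩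
      simp only [Set.mem_inter_iff, Set.mem_insert_iff, Set.mem_singleton_iff] at this
      rcases this with ⟨rfl | rfl, h1 | h1⟩
      · exact hne hu hu' (E.vtx_inj h1)
      · exact hne hu hw (E.vtx_inj h1)
      · exact hne hv hu' (E.vtx_inj h1)
      · exact hne hv hw (E.vtx_inj h1)

theorem joinedIn_subSupport (E : PlaneEmbedding G) {S : Set V} {u v : S}
    (h : (G.induce S).Reachable u v) : JoinedIn (E.subSupport S) (E.vtx u) (E.vtx v) := by
  obtain ⟨p⟩ := h
  induction p with
  | nil => exact JoinedIn.refl (E.vtx_mem_subSupport (Subtype.prop _))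
  | @cons a b c hab _ ih =>
    refine JoinedIn.trans ?_ ih
    have hab' : G.Adj a b := hab
    obtain ⟨γ, -, hγ⟩ := E.arc_path hab'
    exact ⟨γ, fun t => E.arc_subset_subSupport hab' a.2 b.2 (hγ ▸ Set.mem_range_self t)⟩

theorem joinedIn_of_adj (E : PlaneEmbedding G) {u v : V} (h : G.Adj u v) :
    JoinedIn (E.subSupport {u, v}) (E.vtx u) (E.vtx v) := by
  obtain ⟨γ, -, hγ⟩ := E.arc_path h
  exact ⟨γ, fun t => E.arc_subset_subSupport h (by simp) (by simp) (hγ ▸ Set.mem_range_self t)⟩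

theorem isCompact_subSupport [Finite V] (E : PlaneEmbedding G) (S : Set V) :
    IsCompact (E.subSupport S) := by
  refine ((Set.toFinite S).image _).isCompact.union ?_
  refine isCompact_iUnion fun u => isCompact_iUnion fun _ => isCompact_iUnion fun v =>
    isCompact_iUnion fun _ => isCompact_iUnion fun h => ?_
  obtain ⟨γ, -, hγ⟩ := E.arc_path h
  exact hγ ▸ isCompact_range γ.continuous

/-- In an outerplane drawing every vertex can be joined to a common far away point by a
curve meeting only the edges at that vertex. -/
theorem IsOuterplane.exists_escape [Finite V] {E : PlaneEmbedding G} (hE : E.IsOuterplane) :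
    ∃ (O : ℝ × ℝ) (A : V → Set (ℝ × ℝ)), (∀ v, E.vtx v ≠ O) ∧
      (∀ v, JoinedIn (A v) (E.vtx v) O) ∧
      ∀ v S, v ∉ S → Disjoint (A v) (E.subSupport S) := by
  set K := E.subSupport Set.univ with hK
  have hKc : IsCompact K := E.isCompact_subSupport _
  obtain ⟨R, hR0, hR⟩ := hKc.isBounded.exists_pos_norm_lt
  have hrank : 1 < Module.rank ℝ (ℝ × ℝ) := by
    rw [rank_prod', Module.rank_self]; norm_num
  have hsph := isPathConnected_sphere hrank (0 : ℝ × ℝ) hR0.le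
  have hsK : Disjoint (Metric.sphere (0 : ℝ × ℝ) R) K := by
    rw [Set.disjoint_left]
    intro x hx hxK
    have := hR x hxK
    rw [mem_sphere_zero_iff_norm] at hx
    linarith
  obtain ⟨O, hO⟩ := hsph.nonempty
  have key : ∀ v, ∃ A : Set (ℝ × ℝ), JoinedIn A (E.vtx v) O ∧
      Disjoint A (E.subSupport {v}ᶜ) := by
    intro v
    have hvK : E.vtx v ∈ K := E.vtx_mem_subSupport (Set.mem_univ v)
    have hvn : E.vtx v ∉ E.subSupport {v}ᶜ := fun h =>
      Set.disjoint_left.1 (E.disjoint_subSupport (S := {v}) (T := {v}ᶜ) disjoint_compl_right)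
        (E.vtx_mem_subSupport rfl) h
    have hopen : IsOpen ((E.subSupport {v}ᶜ)ᶜ ∩ Metric.ball 0 R) :=
      (E.isCompact_subSupport _).isClosed.isOpen_compl.inter Metric.isOpen_ball
    obtain ⟨ε, hε, hball⟩ := Metric.isOpen_iff.1 hopen (E.vtx v)
      ⟨hvn, by simpa using hR _ hvK⟩
    obtain ⟨q, ⟨hqK, hqu⟩, hqv⟩ := Metric.mem_closure_iff.1 (hE v (Set.mem_univ v)) ε hε
    have hqb : q ∈ Metric.ball (E.vtx v) ε := by rwa [Metric.mem_ball, dist_comm]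
    set W := connectedComponentIn Kᶜ q with hW
    have hqW : q ∈ W := mem_connectedComponentIn hqK
    have hWo : IsOpen W := hKc.isClosed.isOpen_compl.connectedComponentIn
    have hWp : IsPathConnected W :=
      hWo.isConnected_iff_isPathConnected.1 (isConnected_connectedComponentIn_iff.2 hqK)
    obtain ⟨z, hzW, hzR⟩ : ∃ z ∈ W, ‖z‖ = R := by
      have hqR : ‖q‖ ≤ R := by
        have := (hball hqb).2
        rw [mem_ball_zero_iff] at this
        exact this.le
      obtain ⟨y, hyW, hyR⟩ : ∃ y ∈ W, R ≤ ‖y‖ := by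
        by_contra! hcon
        exact hqu ((Metric.isBounded_ball (x := (0 : ℝ × ℝ)) (r := R)).subset
          fun y hy => by simpa using hcon y hy)
      obtain ⟨z, hz, hzR⟩ := hWp.isConnected.isPreconnected.intermediate_value hqW hyW
        continuous_norm.continuousOn ⟨hqR, hyR⟩
      exact ⟨z, hz, hzR⟩
    refine ⟨Metric.ball (E.vtx v) ε ∪ W ∪ Metric.sphere 0 R, ?_, ?_⟩
    · have h1 := (Metric.isPathConnected_ball hε).joinedIn _ (Metric.mem_ball_self hε) _ hqb
      have h2 := hWp.joinedIn _ hqW _ hzW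
      have h3 := hsph.joinedIn z (by simpa using hzR) O hO
      exact (h1.mono fun x hx => Or.inl (Or.inl hx)).trans
        ((h2.mono fun x hx => Or.inl (Or.inr hx)).trans (h3.mono fun x hx => Or.inr hx))
    · have hsub : E.subSupport {v}ᶜ ⊆ K := E.subSupport_mono (Set.subset_univ _)
      rw [Set.disjoint_union_left, Set.disjoint_union_left]
      refine ⟨⟨?_, ?_⟩, hsK.mono_right hsub⟩
      · exact Set.disjoint_left.2 fun x hx => (hball hx).1
      · exact Set.disjoint_left.2 fun x hx hx' =>
          connectedComponentIn_subset _ _ hx (hsub hx')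
  choose A hA hd using key
  refine ⟨O, A, fun v h => ?_, hA, fun v S hv => (hd v).mono_right
    (E.subSupport_mono (by simpa using hv))⟩
  exact Set.disjoint_left.1 hsK hO (h ▸ E.vtx_mem_subSupport (Set.mem_univ v))

end PlaneEmbedding

section Obstructions

variable {V : Type} {G : SimpleGraph V}

/-- A clique `w, x, y, z` together with a neighbour `v` of `w` that is joined to each of
`x, y, z` by a connected set avoiding the other three vertices of the clique. -/
theorem not_isPlanar_of_fan (c : Fin 5 → V) (hc : Function.Injective c)
    (hadj : ∀ i j, i < j → i ≠ 1 → G.Adj (c i) (c j))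
    (F : Fin 5 → Set V)
    (hF : ∀ j, 1 < j → ∃ (h₁ : c 1 ∈ F j) (h₂ : c j ∈ F j),
      (G.induce (F j)).Reachable ⟨c 1, h₁⟩ ⟨c j, h₂⟩)
    (hav : ∀ j k, 1 < j → k ≠ 1 → k ≠ j → c k ∉ F j) : ¬ IsPlanar G := by
  rintro ⟨E⟩
  refine not_weak_drawing_K5 (fun i => E.vtx (c i)) (E.vtx_inj.comp hc)
    (fun i j => E.subSupport (if i = 1 then F j else {c i, c j})) ?_ ?_
  · intro i j hij
    by_cases hi : i = 1
    · subst hi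
      obtain ⟨h₁, h₂, h⟩ := hF j hij
      simpa using E.joinedIn_subSupport h
    · simpa only [if_neg hi] using E.joinedIn_of_adj (hadj i j hij hi)
  · intro a b k d hab hkd hak hbk hbd
    apply E.disjoint_subSupport
    have hk : k ≠ 1 → a ≠ 1 → Disjoint ({c a, c b} : Set V) {c k, c d} := by
      intro _ _
      have had : a ≠ d := (hak.trans hkd).ne
      simp [hc.eq_iff, hak.ne', hbk.symm, had.symm, hbd.symm]
    by_cases ha : a = 1
    · subst ha
      have hk1 : k ≠ 1 := hak.ne'
      rw [if_pos rfl, if_neg hk1, Set.disjoint_right]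
      rintro x (rfl | rfl)
      · exact hav b k hab hk1 hbk.symm
      · exact hav b d hab (hak.trans hkd).ne' hbd.symm
    · by_cases hk1 : k = 1
      · subst hk1
        rw [if_neg ha, if_pos rfl, Set.disjoint_left]
        rintro x (rfl | rfl)
        · exact hav d a hkd ha (hak.trans hkd).ne
        · exact hav d b hkd hbk hbd
      · rw [if_neg ha, if_neg hk1]
        exact hk hk1 ha

/-- An outerplanar graph contains no `K₄`. -/
theorem not_isOuterplanar_of_K4 [Finite V] (c : Fin 4 → V)
    (hadj : ∀ i j, i < j → G.Adj (c i) (c j)) : ¬ IsOuterplanar G := by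
  rintro ⟨E, hE⟩
  have hc : Function.Injective c := by
    intro i j hij
    by_contra hne
    rcases lt_or_gt_of_ne hne with h | h
    · exact (hadj i j h).ne hij
    · exact (hadj j i h).ne hij.symm
  obtain ⟨O, A, hO, hA, hd⟩ := hE.exists_escape
  refine not_weak_drawing_K5 (Fin.cons O fun i => E.vtx (c i))
    (Fin.cons_injective_iff.2 ⟨by rintro ⟨i, hi⟩; exact hO _ hi, E.vtx_inj.comp hc⟩)
    (Fin.cons (Fin.cons ∅ fun j => A (c j))
      fun i => Fin.cons ∅ fun j => E.subSupport {c i, c j}) ?_ ?_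
  · intro i j hij
    induction j using Fin.cases with
    | zero => exact absurd hij (Fin.not_lt_zero i)
    | succ j =>
      induction i using Fin.cases with
      | zero => simpa using (hA (c j)).symm
      | succ i => simpa using E.joinedIn_of_adj (hadj i j (Fin.succ_lt_succ_iff.1 hij))
  · intro a b k d hab hkd hak hbk hbd
    obtain ⟨b, rfl⟩ := Fin.exists_succ_eq.2 (Fin.ne_zero_of_lt hab)
    obtain ⟨k, rfl⟩ := Fin.exists_succ_eq.2 (Fin.ne_zero_of_lt hak)
    obtain ⟨d, rfl⟩ := Fin.exists_succ_eq.2 (Fin.ne_zero_of_lt hkd)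
    have hbk' : b ≠ k := fun h => hbk (h ▸ rfl)
    have hbd' : b ≠ d := fun h => hbd (h ▸ rfl)
    induction a using Fin.cases with
    | zero =>
      simp only [Fin.cons_zero, Fin.cons_succ]
      apply hd
      simp [hc.eq_iff, hbk', hbd']
    | succ a =>
      simp only [Fin.cons_succ]
      apply E.disjoint_subSupport
      have hak' : a ≠ k := fun h => hak.ne (h ▸ rfl)
      have had' : a ≠ d := fun h => (hak.trans hkd).ne (h ▸ rfl)
      simp [hc.eq_iff, hbk'.symm, hbd'.symm, hak'.symm, had'.symm]

/-- An outerplanar graph contains no `K₂,₃`. -/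
theorem not_isOuterplanar_of_K23 [Finite V] (c : Fin 5 → V) (hc : Function.Injective c)
    (hadj : ∀ i j : Fin 5, i.val % 2 = 0 → j.val % 2 = 1 → G.Adj (c i) (c j)) :
    ¬ IsOuterplanar G := by
  rintro ⟨E, hE⟩
  obtain ⟨O, A, hO, hA, hd⟩ := hE.exists_escape
  have heven : ∀ i : Fin 6, i.val % 2 = 0 → ∃ i' : Fin 5, i = i'.castSucc ∧ i'.val % 2 = 0 := by
    decide
  have hodd : ∀ i : Fin 6, i.val % 2 = 1 →
      i = Fin.last 5 ∨ ∃ i' : Fin 5, i = i'.castSucc ∧ i'.val % 2 = 1 := by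
    decide
  refine not_weak_drawing_K33 (Fin.snoc (fun i => E.vtx (c i)) O)
    (Fin.snoc_injective_iff.2 ⟨E.vtx_inj.comp hc, by rintro ⟨i, hi⟩; exact hO _ hi⟩)
    (Fin.snoc (fun i => Fin.snoc (fun j => E.subSupport {c i, c j}) (A (c i)))
      (fun _ => ∅)) ?_ ?_
  · intro i j hi hj
    obtain ⟨i, rfl, hi⟩ := heven i hi
    rcases hodd j hj with rfl | ⟨j, rfl, hj⟩
    · simpa only [Fin.snoc_castSucc, Fin.snoc_last] using hA (c i)
    · simpa using E.joinedIn_of_adj (hadj i j hi hj)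
  · intro a b k d ha hb hk hd' hak hbd
    obtain ⟨a, rfl, ha⟩ := heven a ha
    obtain ⟨k, rfl, hk⟩ := heven k hk
    have hak' : a ≠ k := fun h => hak.ne (h ▸ rfl)
    rcases hodd b hb with rfl | ⟨b, rfl, hb⟩
    · rcases hodd d hd' with rfl | ⟨d, rfl, hd'⟩
      · exact absurd rfl hbd
      · have had : a ≠ d := by rintro rfl; omega
        simp only [Fin.snoc_castSucc, Fin.snoc_last]
        apply hd
        simp [hc.eq_iff, hak', had]
    · have hbk : b ≠ k := by rintro rfl; omega
      rcases hodd d hd' with rfl | ⟨d, rfl, hd'⟩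
      · simp only [Fin.snoc_castSucc, Fin.snoc_last]
        apply (hd _ _ _).symm
        simp [hc.eq_iff, hak'.symm, hbk.symm]
      · have had : a ≠ d := by rintro rfl; omega
        have hbd' : b ≠ d := by rintro rfl; exact hbd rfl
        simp only [Fin.snoc_castSucc]
        apply E.disjoint_subSupport
        simp [hc.eq_iff, hak'.symm, hbk.symm, had.symm, hbd'.symm]

end Obstructions

/-! ### Subdividing a triangle at its centroid -/

section Triangle

/-- The point with barycentric coordinates `w` with respect to the triangle `t`. -/
noncomputable def baryPoint (t : Fin 3 → ℝ × ℝ) (w : Fin 3 → ℝ) : ℝ × ℝ := ∑ a, w a • t a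

/-- The centroid of a triangle. -/
noncomputable def centroidPt (t : Fin 3 → ℝ × ℝ) : ℝ × ℝ := (1 / 3 : ℝ) • ∑ a, t a

/-- The open triangle spanned by three points. -/
def openTriangle (t : Fin 3 → ℝ × ℝ) : Set (ℝ × ℝ) :=
  {x | ∃ w : Fin 3 → ℝ, (∀ a, 0 < w a) ∧ ∑ a, w a = 1 ∧ baryPoint t w = x}

/-- Barycentric coordinates with respect to `t` are unique. -/
def NondegTriangle (t : Fin 3 → ℝ × ℝ) : Prop :=
  ∀ w w' : Fin 3 → ℝ, ∑ a, w a = 1 → ∑ a, w' a = 1 → baryPoint t w = baryPoint t w' → w = w'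

/-- The triangle in which the corner `j` is replaced by the centroid. -/
noncomputable def subTriangle (t : Fin 3 → ℝ × ℝ) (j : Fin 3) : Fin 3 → ℝ × ℝ :=
  Function.update t j (centroidPt t)

/-- Change of coordinates from `subTriangle t j` to `t`. -/
noncomputable def liftCoord (j : Fin 3) (w : Fin 3 → ℝ) : Fin 3 → ℝ :=
  fun a => (if a = j then 0 else w a) + w j / 3

/-- Coordinates of the points of the segment from the centroid to the corner `a`. -/
noncomputable def spokeCoord (a : Fin 3) (s : ℝ) : Fin 3 → ℝ :=
  fun b => (1 - s) / 3 + if b = a then s else 0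

variable {t : Fin 3 → ℝ × ℝ}

theorem baryPoint_subTriangle (j : Fin 3) (w : Fin 3 → ℝ) :
    baryPoint (subTriangle t j) w = baryPoint t (liftCoord j w) := by
  fin_cases j <;>
  · simp [baryPoint, subTriangle, liftCoord, centroidPt, Fin.sum_univ_three]
    module

theorem sum_liftCoord (j : Fin 3) (w : Fin 3 → ℝ) : ∑ a, liftCoord j w a = ∑ a, w a := by
  fin_cases j <;>
  · simp [liftCoord, Fin.sum_univ_three]
    ring

theorem sum_spokeCoord (a : Fin 3) (s : ℝ) : ∑ b, spokeCoord a s b = 1 := by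
  fin_cases a <;>
  · simp [spokeCoord, Fin.sum_univ_three]
    ring

theorem NondegTriangle.subTriangle (ht : NondegTriangle t) (j : Fin 3) :
    NondegTriangle (subTriangle t j) := by
  intro w w' hw hw' h
  rw [baryPoint_subTriangle, baryPoint_subTriangle] at h
  have := ht _ _ (by rw [sum_liftCoord, hw]) (by rw [sum_liftCoord, hw']) h
  have hj : w j = w' j := by
    have := congrFun this j
    simp only [liftCoord, if_true] at this
    linarith
  funext a
  by_cases ha : a = j
  · rw [ha, hj]
  · have := congrFun this a
    simp only [liftCoord, if_neg ha] at this
    linarith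

theorem exists_coord_of_mem_subTriangle {j : Fin 3} {x : ℝ × ℝ}
    (hx : x ∈ openTriangle (subTriangle t j)) :
    ∃ w : Fin 3 → ℝ, (∀ a, 0 < w a) ∧ ∑ a, w a = 1 ∧ baryPoint t w = x ∧
      ∀ a, a ≠ j → w j < w a := by
  obtain ⟨w, hw, hs, rfl⟩ := hx
  refine ⟨liftCoord j w, fun a => ?_, by rw [sum_liftCoord, hs],
    (baryPoint_subTriangle j w).symm, fun a ha => ?_⟩
  · have := hw j
    have := hw a
    simp only [liftCoord]
    split_ifs <;> linarith
  · have := hw a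
    simp only [liftCoord, if_neg ha, if_true]
    linarith

theorem openTriangle_subTriangle_subset (j : Fin 3) :
    openTriangle (subTriangle t j) ⊆ openTriangle t := fun _ hx =>
  let ⟨w, h1, h2, h3, _⟩ := exists_coord_of_mem_subTriangle hx
  ⟨w, h1, h2, h3⟩

theorem disjoint_subTriangle (ht : NondegTriangle t) {j k : Fin 3} (hjk : j ≠ k) :
    Disjoint (openTriangle (subTriangle t j)) (openTriangle (subTriangle t k)) := by
  rw [Set.disjoint_left]
  intro x hx hy
  obtain ⟨w, -, hs, hw, hlt⟩ := exists_coord_of_mem_subTriangle hx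
  obtain ⟨w', -, hs', hw', hlt'⟩ := exists_coord_of_mem_subTriangle hy
  obtain rfl := ht w w' hs hs' (hw.trans hw'.symm)
  exact (hlt k hjk.symm).asymm (hlt' j hjk)

theorem exists_coord_of_mem_spoke {a : Fin 3} {x : ℝ × ℝ}
    (hx : x ∈ segment ℝ (centroidPt t) (t a)) :
    ∃ s : ℝ, 0 ≤ s ∧ s ≤ 1 ∧ x = baryPoint t (spokeCoord a s) ∧ (s = 0 → x = centroidPt t) ∧
      (s = 1 → x = t a) := by
  obtain ⟨r, s, hr, hs, hrs, rfl⟩ := hx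
  obtain rfl : r = 1 - s := by linarith
  refine ⟨s, hs, by linarith, ?_, by rintro rfl; simp, by rintro rfl; simp⟩
  fin_cases a <;>
  · simp [baryPoint, spokeCoord, centroidPt, Fin.sum_univ_three]
    module

theorem centroidPt_mem_openTriangle : centroidPt t ∈ openTriangle t :=
  ⟨fun _ => 1 / 3, fun _ => by norm_num, by simp, by simp [baryPoint, centroidPt, Finset.smul_sum]⟩

theorem spoke_subset (a : Fin 3) :
    segment ℝ (centroidPt t) (t a) ⊆ insert (t a) (openTriangle t) := by
  intro x hx
  obtain ⟨s, hs, hs1, rfl, -, h1⟩ := exists_coord_of_mem_spoke hx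
  rcases hs1.eq_or_lt with h | h
  · exact Or.inl (h1 h)
  · refine Or.inr ⟨_, fun b => ?_, sum_spokeCoord a s, rfl⟩
    simp only [spokeCoord]
    split_ifs <;> linarith

theorem disjoint_spoke_subTriangle (ht : NondegTriangle t) (a j : Fin 3) :
    Disjoint (segment ℝ (centroidPt t) (t a)) (openTriangle (subTriangle t j)) := by
  rw [Set.disjoint_left]
  intro x hx hy
  obtain ⟨w, -, hw, hwx, hlt⟩ := exists_coord_of_mem_subTriangle hy
  obtain ⟨s, hs, hs1, hsx, -⟩ := exists_coord_of_mem_spoke hx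
  obtain rfl := ht w _ hw (sum_spokeCoord a s) (hwx.trans hsx)
  have hthird : ∀ a j : Fin 3, ∃ b : Fin 3, b ≠ j ∧ b ≠ a := by decide
  obtain ⟨b, hbj, hba⟩ := hthird a j
  have := hlt b hbj
  simp only [spokeCoord, if_neg hba] at this
  split_ifs at this <;> linarith

theorem spoke_inter_spoke (ht : NondegTriangle t) {a b : Fin 3} (hab : a ≠ b) {x : ℝ × ℝ}
    (ha : x ∈ segment ℝ (centroidPt t) (t a)) (hb : x ∈ segment ℝ (centroidPt t) (t b)) :
    x = centroidPt t := by
  obtain ⟨s, hs, hs1, hsx, h0, -⟩ := exists_coord_of_mem_spoke ha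
  obtain ⟨r, hr, hr1, hrx, -⟩ := exists_coord_of_mem_spoke hb
  have h := ht _ _ (sum_spokeCoord a s) (sum_spokeCoord b r) (hsx.symm.trans hrx)
  have h1 := congrFun h a
  have h2 := congrFun h b
  simp only [spokeCoord, if_true, if_neg hab, if_neg hab.symm] at h1 h2
  exact h0 (by linarith)

end Triangle

/-! ### Stacked triangulations -/

/-- `par i` is the triangle into which the vertex `i ≥ 3` is inserted; for `i > 3` it arises
from the triangle of the earlier vertex `m = (face i).1` by replacing its corner `(face i).2`
by `m`, and every triangle is used at most once. -/
structure IsStacking (par : ℕ → Fin 3 → ℕ) (face : ℕ → ℕ × Fin 3) : Prop where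
  root : par 3 = ![0, 1, 2]
  le_face : ∀ i, 3 < i → 3 ≤ (face i).1
  face_lt : ∀ i, 3 < i → (face i).1 < i
  par_eq : ∀ i, 3 < i → par i = Function.update (par (face i).1) (face i).2 (face i).1
  face_inj : ∀ i j, 3 < i → 3 < j → face i = face j → i = j

/-- `i` is an earlier neighbour of `j`. -/
def StackLink (par : ℕ → Fin 3 → ℕ) (i j : ℕ) : Prop := i < j ∧ (j < 3 ∨ ∃ a, par j a = i)

/-- The graph of a stacking: a triangle on `0, 1, 2`, and every later vertex is joined to the
corners of its triangle. -/
def stackGraph (par : ℕ → Fin 3 → ℕ) : SimpleGraph ℕ where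
  Adj i j := StackLink par i j ∨ StackLink par j i
  symm := ⟨fun _ _ h => h.symm⟩
  loopless := ⟨fun _ h => h.elim (fun h => h.1.ne rfl) (fun h => h.1.ne rfl)⟩

/-- The stacked triangulation on the first `n` vertices. -/
def stackGraphFin (par : ℕ → Fin 3 → ℕ) (n : ℕ) : SimpleGraph (Fin n) :=
  (stackGraph par).comap Fin.val

/-- The straight line drawing of a stacking that inserts every vertex at a centroid. -/
noncomputable def stackPos (par : ℕ → Fin 3 → ℕ) : ℕ → ℝ × ℝ
  | 0 => (0, 0)
  | 1 => (1, 0)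
  | 2 => (0, 1)
  | n + 3 => (1 / 3 : ℝ) •
      ∑ a, if _ : par (n + 3) a < n + 3 then stackPos par (par (n + 3) a) else 0

namespace IsStacking

variable {par : ℕ → Fin 3 → ℕ} {face : ℕ → ℕ × Fin 3}

theorem par_lt (h : IsStacking par face) {i : ℕ} (hi : 3 ≤ i) (a : Fin 3) : par i a < i := by
  induction i using Nat.strong_induction_on with
  | _ i ih =>
    rcases hi.eq_or_lt with rfl | hi
    · rw [h.root]; fin_cases a <;> simp
    · rw [h.par_eq i hi, Function.update_apply]
      have := h.face_lt i hi
      split_ifs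
      · exact this
      · exact (ih _ this (h.le_face i hi)).trans this

theorem par_injective (h : IsStacking par face) {i : ℕ} (hi : 3 ≤ i) :
    Function.Injective (par i) := by
  induction i using Nat.strong_induction_on with
  | _ i ih =>
    rcases hi.eq_or_lt with rfl | hi
    · rw [h.root]; decide
    · rw [h.par_eq i hi]
      have hm := h.le_face i hi
      have hinj := ih _ (h.face_lt i hi) hm
      intro a b hab
      simp only [Function.update_apply] at hab
      split_ifs at hab with h1 h2 h2
      · rw [h1, h2]
      · exact absurd hab.symm (h.par_lt hm b).ne
      · exact absurd hab (h.par_lt hm a).ne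
      · exact hinj hab

theorem link_par (h : IsStacking par face) {i : ℕ} (hi : 3 ≤ i) (a : Fin 3) :
    StackLink par (par i a) i := ⟨h.par_lt hi a, Or.inr ⟨a, rfl⟩⟩

theorem par_adj_par (h : IsStacking par face) {i : ℕ} (hi : 3 ≤ i) {a b : Fin 3} (hab : a ≠ b) :
    (stackGraph par).Adj (par i a) (par i b) := by
  induction i using Nat.strong_induction_on with
  | _ i ih =>
    rcases hi.eq_or_lt with rfl | hi
    · rw [h.root]
      revert hab
      fin_cases a <;> fin_cases b <;> simp [stackGraph, StackLink]
    · rw [h.par_eq i hi]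
      have hm := h.le_face i hi
      simp only [Function.update_apply]
      split_ifs with h1 h2 h2
      · exact absurd (h1.trans h2.symm) hab
      · exact Or.inr (h.link_par hm b)
      · exact Or.inl (h.link_par hm a)
      · exact ih _ (h.face_lt i hi) hm

/-- Deleting two vertices from a stacked triangulation leaves a connected graph. -/
theorem reachable_avoiding (h : IsStacking par face) (n y z : ℕ) {u v : ℕ}
    (hu : u < n ∧ u ≠ y ∧ u ≠ z) (hv : v < n ∧ v ≠ y ∧ v ≠ z) :
    ((stackGraph par).induce {m | m < n ∧ m ≠ y ∧ m ≠ z}).Reachable ⟨u, hu⟩ ⟨v, hv⟩ := by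
  suffices H : ∀ k, ∀ u v, u ≤ v → v < k → ∀ (hu : u < n ∧ u ≠ y ∧ u ≠ z)
      (hv : v < n ∧ v ≠ y ∧ v ≠ z),
      ((stackGraph par).induce {m | m < n ∧ m ≠ y ∧ m ≠ z}).Reachable ⟨u, hu⟩ ⟨v, hv⟩ by
    rcases le_total u v with huv | huv
    · exact H (v + 1) u v huv (by omega) hu hv
    · exact (H (u + 1) v u huv (by omega) hv hu).symm
  intro k
  induction k with
  | zero => intro u v _ hv; omega
  | succ k ih =>
    intro u v huv hvk hu hv
    rcases huv.eq_or_lt with rfl | huv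
    · exact SimpleGraph.Reachable.refl _
    · by_cases hv3 : v < 3
      · exact SimpleGraph.Adj.reachable (Or.inl ⟨huv, Or.inl hv3⟩ : (stackGraph par).Adj u v)
      · push Not at hv3
        obtain ⟨a, hay, haz⟩ : ∃ a, par v a ≠ y ∧ par v a ≠ z := by
          by_contra! hcon
          have hinj := h.par_injective hv3
          have h0 := hcon 0
          have h1 := hcon 1
          have h2 := hcon 2
          have h01 := hinj.ne (show (0 : Fin 3) ≠ 1 by decide)
          have h02 := hinj.ne (show (0 : Fin 3) ≠ 2 by decide)
          have h12 := hinj.ne (show (1 : Fin 3) ≠ 2 by decide)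
          omega
        have hav := h.par_lt hv3 a
        have hp : par v a < n ∧ par v a ≠ y ∧ par v a ≠ z := ⟨by omega, hay, haz⟩
        have hadj : ((stackGraph par).induce {m | m < n ∧ m ≠ y ∧ m ≠ z}).Adj
            ⟨par v a, hp⟩ ⟨v, hv⟩ := Or.inl (h.link_par hv3 a)
        refine SimpleGraph.Reachable.trans (v := ⟨par v a, hp⟩) ?_ hadj.reachable
        rcases le_total u (par v a) with hle | hle
        · exact ih _ _ hle (by omega) hu hp
        · exact (ih _ _ hle (by omega) hp hu).symm

end IsStacking

namespace IsStacking

variable {par : ℕ → Fin 3 → ℕ} {face : ℕ → ℕ × Fin 3}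

theorem not_isPlanar_of_lt (h : IsStacking par face) {n : ℕ} {v w : Fin n} (hvw : v < w)
    (hna : ¬ (stackGraphFin par n).Adj v w) {G : SimpleGraph (Fin n)}
    (hle : stackGraphFin par n ≤ G) (hG : G.Adj v w) : ¬ IsPlanar G := by
  have hw : 3 ≤ w.val := by
    by_contra hw
    exact hna (Or.inl ⟨hvw, Or.inl (by omega)⟩)
  have hlt := h.par_lt hw
  let p : Fin 3 → Fin n := fun a => ⟨par w a, (hlt a).trans w.2⟩
  have hpw : ∀ a, p a < w := hlt
  have hpinj : Function.Injective p := fun a b hab =>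
    h.par_injective hw (congrArg Fin.val hab)
  have hpv : ∀ a, p a ≠ v := by
    rintro a rfl
    exact hna (Or.inl (h.link_par hw a))
  have hpadj : ∀ a b, a ≠ b → G.Adj (p a) (p b) := fun a b hab => hle (h.par_adj_par hw hab)
  have hwadj : ∀ a, G.Adj w (p a) := fun a => hle (Or.inr (h.link_par hw a))
  have hothers : ∀ a : Fin 3, ∃ b c, a ≠ b ∧ a ≠ c ∧ ∀ d, d ≠ a → d = b ∨ d = c := by decide
  have key : ∀ a : Fin 3, ∃ (h₁ : v ∈ {m : Fin n | m < w ∧ ∀ b, b ≠ a → m ≠ p b})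
        (h₂ : p a ∈ {m : Fin n | m < w ∧ ∀ b, b ≠ a → m ≠ p b}),
        (G.induce {m : Fin n | m < w ∧ ∀ b, b ≠ a → m ≠ p b}).Reachable ⟨v, h₁⟩ ⟨p a, h₂⟩ := by
    intro a
    obtain ⟨b, c, hab, hac, hbc⟩ := hothers a
    refine ⟨⟨hvw, fun b _ => (hpv b).symm⟩, ⟨hpw a, fun b hb => hpinj.ne hb.symm⟩, ?_⟩
    have hr := h.reachable_avoiding w (par w b) (par w c) (u := v) (v := par w a)
      ⟨hvw, fun e => hpv b (Fin.ext e.symm), fun e => hpv c (Fin.ext e.symm)⟩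
      ⟨hlt a, (h.par_injective hw).ne hab, (h.par_injective hw).ne hac⟩
    let f : (stackGraph par).induce {m | m < w.val ∧ m ≠ par w b ∧ m ≠ par w c} →g
        G.induce {m : Fin n | m < w ∧ ∀ b, b ≠ a → m ≠ p b} :=
      { toFun := fun m => ⟨⟨m.1, m.2.1.trans w.2⟩, m.2.1, fun d hd e => by
          rcases hbc d hd with rfl | rfl
          · exact m.2.2.1 (congrArg Fin.val e)
          · exact m.2.2.2 (congrArg Fin.val e)⟩
        map_rel' := fun {_ _} hadj => hle hadj }
    exact hr.map f
  refine not_isPlanar_of_fan (Fin.cons w (Fin.cons v p)) ?_ ?_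
    (Fin.cons ∅ (Fin.cons ∅ fun a => {m | m < w ∧ ∀ b, b ≠ a → m ≠ p b})) ?_ ?_
  · refine Fin.cons_injective_iff.2 ⟨?_, Fin.cons_injective_iff.2 ⟨?_, hpinj⟩⟩
    · rintro ⟨j, hj⟩
      induction j using Fin.cases with
      | zero => exact hvw.ne hj
      | succ j => exact (hpw j).ne hj
    · rintro ⟨j, hj⟩
      exact hpv j hj
  · intro i j hij hi
    induction i using Fin.cases with
    | zero =>
      induction j using Fin.cases with
      | zero => exact absurd hij (lt_irrefl _)
      | succ j =>
        induction j using Fin.cases with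
        | zero => exact hG.symm
        | succ j => exact hwadj j
    | succ i =>
      induction i using Fin.cases with
      | zero => exact absurd rfl hi
      | succ i =>
        induction j using Fin.cases with
        | zero => exact absurd hij (Fin.not_lt_zero _)
        | succ j =>
          induction j using Fin.cases with
          | zero => exact absurd (Fin.succ_lt_succ_iff.1 hij) (Fin.not_lt_zero _)
          | succ j =>
            exact hpadj i j (Fin.succ_lt_succ_iff.1 (Fin.succ_lt_succ_iff.1 hij)).ne
  · intro j hj
    induction j using Fin.cases with
    | zero => exact absurd hj (Fin.not_lt_zero _)
    | succ j =>
      induction j using Fin.cases with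
      | zero => exact absurd hj (lt_irrefl _)
      | succ j => exact key j
  · intro j k hj hk hkj
    induction j using Fin.cases with
    | zero => exact absurd hj (Fin.not_lt_zero _)
    | succ j =>
      induction j using Fin.cases with
      | zero => exact absurd hj (lt_irrefl _)
      | succ j =>
        induction k using Fin.cases with
        | zero => exact fun hm => lt_irrefl _ hm.1
        | succ k =>
          induction k using Fin.cases with
          | zero => exact absurd rfl hk
          | succ k => exact fun hm => hm.2 k (by rintro rfl; exact hkj rfl) rfl

theorem not_isPlanar_sup_edge (h : IsStacking par face) {n : ℕ} {u v : Fin n} (huv : u ≠ v)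
    (hna : ¬ (stackGraphFin par n).Adj u v) :
    ¬ IsPlanar (stackGraphFin par n ⊔ SimpleGraph.fromEdgeSet {s(u, v)}) := by
  have hG : (stackGraphFin par n ⊔ SimpleGraph.fromEdgeSet {s(u, v)}).Adj u v :=
    Or.inr (by simp [huv])
  rcases huv.lt_or_gt with hlt | hlt
  · exact h.not_isPlanar_of_lt hlt hna le_sup_left hG
  · exact h.not_isPlanar_of_lt hlt (fun e => hna e.symm) le_sup_left hG.symm

end IsStacking

/-! ### The straight line drawing of a stacked triangulation -/

/-- The triangle of the drawing into which the vertex `i` is inserted. -/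
noncomputable def stackTri (par : ℕ → Fin 3 → ℕ) (i : ℕ) : Fin 3 → ℝ × ℝ :=
  fun a => stackPos par (par i a)

section BaseTriangle

variable {par : ℕ → Fin 3 → ℕ}

theorem mem_segment_zero_one {x : ℝ × ℝ}
    (hx : x ∈ segment ℝ (stackPos par 0) (stackPos par 1)) : x.2 = 0 := by
  obtain ⟨a, b, _, _, _, rfl⟩ := hx
  simp [stackPos]

theorem mem_segment_zero_two {x : ℝ × ℝ}
    (hx : x ∈ segment ℝ (stackPos par 0) (stackPos par 2)) : x.1 = 0 := by
  obtain ⟨a, b, _, _, _, rfl⟩ := hx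
  simp [stackPos]

theorem mem_segment_one_two {x : ℝ × ℝ}
    (hx : x ∈ segment ℝ (stackPos par 1) (stackPos par 2)) : x.1 + x.2 = 1 := by
  obtain ⟨a, b, _, _, hab, rfl⟩ := hx
  simpa [stackPos] using hab

theorem base_segment_inter {l j l' j' : ℕ} (hlj : l < j) (hj : j < 3) (hlj' : l' < j')
    (hj' : j' < 3) (hne : (l, j) ≠ (l', j')) {x : ℝ × ℝ}
    (hx : x ∈ segment ℝ (stackPos par l) (stackPos par j))
    (hx' : x ∈ segment ℝ (stackPos par l') (stackPos par j')) :
    x ∈ ({stackPos par l, stackPos par j} : Set (ℝ × ℝ)) ∩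
      {stackPos par l', stackPos par j'} := by
  wlog hle : j < j' ∨ j = j' ∧ l < l' generalizing l j l' j'
  · refine (this hlj' hj' hlj hj hne.symm hx' hx ?_).symm
    have : ¬ (l = l' ∧ j = j') := fun e => hne (by rw [e.1, e.2])
    omega
  have hcase : (l = 0 ∧ j = 1 ∧ l' = 0 ∧ j' = 2) ∨ (l = 0 ∧ j = 1 ∧ l' = 1 ∧ j' = 2) ∨
      (l = 0 ∧ j = 2 ∧ l' = 1 ∧ j' = 2) := by omega
  obtain ⟨x₁, x₂⟩ := x
  rcases hcase with ⟨rfl, rfl, rfl, rfl⟩ | ⟨rfl, rfl, rfl, rfl⟩ | ⟨rfl, rfl, rfl, rfl⟩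
  · have h1 := mem_segment_zero_one hx
    have h2 := mem_segment_zero_two hx'
    simp_all [stackPos]
  · have h1 := mem_segment_zero_one hx
    have h2 := mem_segment_one_two hx'
    simp_all [stackPos]
  · have h1 := mem_segment_zero_two hx
    have h2 := mem_segment_one_two hx'
    simp_all [stackPos]

theorem stackPos_ne_of_lt_three {k i : ℕ} (hki : k < i) (hi : i < 3) :
    stackPos par k ≠ stackPos par i := by
  have hcase : (k = 0 ∧ i = 1) ∨ (k = 0 ∧ i = 2) ∨ (k = 1 ∧ i = 2) := by omega
  rcases hcase with ⟨rfl, rfl⟩ | ⟨rfl, rfl⟩ | ⟨rfl, rfl⟩ <;> simp [stackPos]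

end BaseTriangle

namespace IsStacking

variable {par : ℕ → Fin 3 → ℕ} {face : ℕ → ℕ × Fin 3}

theorem stackPos_eq (h : IsStacking par face) {i : ℕ} (hi : 3 ≤ i) :
    stackPos par i = centroidPt (stackTri par i) := by
  obtain ⟨n, rfl⟩ := Nat.exists_eq_add_of_le' hi
  rw [stackPos, centroidPt]
  congr 1
  exact Finset.sum_congr rfl fun a _ => dif_pos (h.par_lt hi a)

theorem stackTri_eq (h : IsStacking par face) {i : ℕ} (hi : 3 < i) :
    stackTri par i = subTriangle (stackTri par (face i).1) (face i).2 := by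
  funext a
  rw [subTriangle, ← h.stackPos_eq (h.le_face i hi)]
  simp only [stackTri, h.par_eq i hi, Function.update_apply]
  split_ifs <;> rfl

theorem nondegTriangle (h : IsStacking par face) {i : ℕ} (hi : 3 ≤ i) :
    NondegTriangle (stackTri par i) := by
  induction i using Nat.strong_induction_on with
  | _ i ih =>
    rcases hi.eq_or_lt with rfl | hi
    · intro w w' hw hw' e
      simp only [baryPoint, stackTri, h.root, Fin.sum_univ_three] at e hw hw'
      simp [stackPos] at e
      funext a
      fin_cases a
      · simp only [Fin.zero_eta]
        linarith [e.1, e.2]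
      · exact e.1
      · exact e.2
    · rw [h.stackTri_eq hi]
      exact (ih _ (h.face_lt i hi) (h.le_face i hi)).subTriangle _

theorem openTriangle_subset_face (h : IsStacking par face) {i : ℕ} (hi : 3 < i) :
    openTriangle (stackTri par i) ⊆ openTriangle (stackTri par (face i).1) := by
  rw [h.stackTri_eq hi]
  exact openTriangle_subTriangle_subset _

theorem openTriangle_subset_root (h : IsStacking par face) {i : ℕ} (hi : 3 ≤ i) :
    openTriangle (stackTri par i) ⊆ openTriangle (stackTri par 3) := by
  induction i using Nat.strong_induction_on with
  | _ i ih =>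
    rcases hi.eq_or_lt with rfl | hi
    · exact subset_rfl
    · exact (h.openTriangle_subset_face hi).trans (ih _ (h.face_lt i hi) (h.le_face i hi))

theorem openTriangle_root_subset (h : IsStacking par face) :
    openTriangle (stackTri par 3) ⊆ {x | 0 < x.1 ∧ 0 < x.2 ∧ x.1 + x.2 < 1} := by
  rintro x ⟨w, hw, hs, rfl⟩
  have h0 := hw 0
  have h1 := hw 1
  have h2 := hw 2
  simp only [Fin.sum_univ_three] at hs
  simp [baryPoint, stackTri, h.root, Fin.sum_univ_three, stackPos]
  exact ⟨h1, h2, by linarith⟩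

/-- The triangles of two vertices are disjoint unless one of the vertices is inserted into the
triangle of the other. -/
theorem disjoint_openTriangle_subTriangle (h : IsStacking par face) {i m : ℕ} {j : Fin 3}
    (hm : 3 ≤ m) (hmi : m < i) (hfree : ∀ k, m < k → k ≤ i → face k ≠ (m, j)) :
    Disjoint (openTriangle (stackTri par i)) (openTriangle (subTriangle (stackTri par m) j)) := by
  induction i using Nat.strong_induction_on generalizing m j with
  | _ i ih =>
    have hi : 3 < i := by omega
    have hlt := h.face_lt i hi
    have hle := h.le_face i hi
    rcases lt_trichotomy (face i).1 m with hlt' | heq | hgt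
    · rw [h.stackTri_eq hi]
      refine ((ih m hmi hle hlt' fun k hk hkm hface => ?_).mono_left
        (openTriangle_subTriangle_subset j)).symm
      have := h.face_inj k i (by omega) hi hface
      omega
    · rw [h.stackTri_eq hi, heq]
      refine disjoint_subTriangle (h.nondegTriangle hm) fun hj => ?_
      exact hfree i hmi le_rfl (Prod.ext heq hj)
    · exact (ih _ hlt hm hgt fun k hk hki => hfree k hk (by omega)).mono_left
        (h.openTriangle_subset_face hi)

theorem disjoint_base_segment (h : IsStacking par face) {l j i : ℕ} (hlj : l < j) (hj : j < 3)
    (hi : 3 ≤ i) :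
    Disjoint (segment ℝ (stackPos par l) (stackPos par j)) (openTriangle (stackTri par i)) := by
  rw [Set.disjoint_left]
  intro x hx hxi
  obtain ⟨h1, h2, h3⟩ := h.openTriangle_root_subset (h.openTriangle_subset_root hi hxi)
  have hcase : (l = 0 ∧ j = 1) ∨ (l = 0 ∧ j = 2) ∨ (l = 1 ∧ j = 2) := by omega
  rcases hcase with ⟨rfl, rfl⟩ | ⟨rfl, rfl⟩ | ⟨rfl, rfl⟩
  · linarith [mem_segment_zero_one hx]
  · linarith [mem_segment_zero_two hx]
  · linarith [mem_segment_one_two hx]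

theorem segment_subset (h : IsStacking par face) {l j : ℕ} (hj : 3 ≤ j) (hl : StackLink par l j) :
    segment ℝ (stackPos par l) (stackPos par j) ⊆
      insert (stackPos par l) (openTriangle (stackTri par j)) := by
  obtain ⟨-, hj' | ⟨a, rfl⟩⟩ := hl
  · omega
  · rw [segment_symm, h.stackPos_eq hj]
    exact spoke_subset a

/-- The edges among the vertices before `i` avoid the triangle of `i`. -/
theorem disjoint_segment (h : IsStacking par face) {l j i : ℕ} (hl : StackLink par l j)
    (hji : j < i) (hi : 3 ≤ i) :
    Disjoint (segment ℝ (stackPos par l) (stackPos par j)) (openTriangle (stackTri par i)) := by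
  induction i using Nat.strong_induction_on generalizing j l with
  | _ i ih =>
    induction j using Nat.strong_induction_on generalizing l with
    | _ j ihj =>
      by_cases hj : j < 3
      · exact h.disjoint_base_segment hl.1 hj hi
      push Not at hj
      have hi3 : 3 < i := by omega
      have hlt := h.face_lt i hi3
      have hle := h.le_face i hi3
      rcases lt_trichotomy (face i).1 j with hlt' | heq | hgt
      · refine Disjoint.mono_left (h.segment_subset hj hl) ?_
        rw [← Set.singleton_union, Set.disjoint_union_left, Set.disjoint_singleton_left]
        constructor
        · by_cases hl3 : 3 ≤ l
          · exact Set.disjoint_left.1 (ihj l hl.1 (h.link_par hl3 0) (hl.1.trans hji))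
              (right_mem_segment ℝ _ _)
          · rcases Nat.eq_zero_or_pos l with rfl | hpos
            · exact Set.disjoint_left.1 (h.disjoint_base_segment (l := 0) (j := 1)
                (by omega) (by omega) hi) (left_mem_segment ℝ _ _)
            · exact Set.disjoint_left.1 (h.disjoint_base_segment (l := 0) hpos
                (by omega) hi) (right_mem_segment ℝ _ _)
        · rw [h.stackTri_eq hi3]
          refine h.disjoint_openTriangle_subTriangle hle hlt' fun k hk hkj hface => ?_
          have := h.face_inj k i (by omega) hi3 hface
          omega
      · obtain ⟨-, hj' | ⟨a, rfl⟩⟩ := hl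
        · omega
        · rw [h.stackTri_eq hi3, heq, segment_symm, h.stackPos_eq hj]
          exact disjoint_spoke_subTriangle (h.nondegTriangle hj) a _
      · exact (ih _ hlt hl hgt hle).mono_right (h.openTriangle_subset_face hi3)

theorem stackPos_mem_openTriangle (h : IsStacking par face) {i : ℕ} (hi : 3 ≤ i) :
    stackPos par i ∈ openTriangle (stackTri par i) := by
  rw [h.stackPos_eq hi]
  exact centroidPt_mem_openTriangle

theorem stackPos_notMem_openTriangle (h : IsStacking par face) {k i : ℕ} (hki : k < i)
    (hi : 3 ≤ i) : stackPos par k ∉ openTriangle (stackTri par i) := by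
  by_cases hk : 3 ≤ k
  · exact Set.disjoint_left.1 (h.disjoint_segment (h.link_par hk 0) hki hi)
      (right_mem_segment ℝ _ _)
  · rcases Nat.eq_zero_or_pos k with rfl | hpos
    · exact Set.disjoint_left.1 (h.disjoint_base_segment (l := 0) (j := 1)
        (by omega) (by omega) hi) (left_mem_segment ℝ _ _)
    · exact Set.disjoint_left.1 (h.disjoint_base_segment (l := 0) hpos
        (by omega) hi) (right_mem_segment ℝ _ _)

theorem stackPos_injective (h : IsStacking par face) : Function.Injective (stackPos par) := by
  refine Function.Injective.of_lt_imp_ne fun k i hki => ?_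
  by_cases hi : 3 ≤ i
  · intro e
    exact h.stackPos_notMem_openTriangle hki hi (e ▸ h.stackPos_mem_openTriangle hi)
  · exact stackPos_ne_of_lt_three hki (by omega)

theorem eq_of_stackPos_mem_segment (h : IsStacking par face) {l j w : ℕ}
    (hl : StackLink par l j) (hw : stackPos par w ∈ segment ℝ (stackPos par l) (stackPos par j)) :
    w = l ∨ w = j := by
  have hlj := hl.1
  rcases lt_trichotomy w j with hwj | rfl | hwj
  · by_cases hj : 3 ≤ j
    · rcases h.segment_subset hj hl hw with e | e
      · exact Or.inl (h.stackPos_injective e)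
      · exact absurd e (h.stackPos_notMem_openTriangle hwj hj)
    · by_contra! hcon
      rcases hcon.1.lt_or_gt with hwl | hwl
      · have := (base_segment_inter (par := par) hlj (by omega) hwl (by omega)
          (by simp; omega) hw (left_mem_segment ℝ _ _)).1
        rcases this with e | e <;> have := h.stackPos_injective e <;> omega
      · have := (base_segment_inter (par := par) hlj (by omega) hwj (by omega)
          (by simp; omega) hw (left_mem_segment ℝ _ _)).1
        rcases this with e | e <;> have := h.stackPos_injective e <;> omega
  · exact Or.inr rfl
  · by_cases hw3 : 3 ≤ w
    · exact absurd (h.stackPos_mem_openTriangle hw3)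
        (Set.disjoint_left.1 (h.disjoint_segment hl hwj hw3) hw)
    · have := (base_segment_inter (par := par) hlj (by omega) hwj (by omega)
        (by simp; omega) hw (right_mem_segment ℝ _ _)).1
      rcases this with e | e
      · exact Or.inl (h.stackPos_injective e)
      · exact Or.inr (h.stackPos_injective e)

theorem segment_inter_segment (h : IsStacking par face) {l j l' j' : ℕ}
    (hl : StackLink par l j) (hl' : StackLink par l' j') (hne : (l, j) ≠ (l', j')) :
    segment ℝ (stackPos par l) (stackPos par j) ∩ segment ℝ (stackPos par l') (stackPos par j') ⊆
      ({stackPos par l, stackPos par j} : Set (ℝ × ℝ)) ∩ {stackPos par l', stackPos par j'} := by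
  wlog hle : j ≤ j' generalizing l j l' j'
  · rw [Set.inter_comm, Set.inter_comm {stackPos par l, _}]
    exact this hl' hl hne.symm (by omega)
  rintro x ⟨hx, hx'⟩
  by_cases hj' : 3 ≤ j'
  · rcases hle.lt_or_eq with hlt | rfl
    · rcases h.segment_subset hj' hl' hx' with rfl | hR
      · refine ⟨?_, Or.inl rfl⟩
        rcases h.eq_of_stackPos_mem_segment hl hx with rfl | rfl
        · exact Or.inl rfl
        · exact Or.inr rfl
      · exact absurd hR (Set.disjoint_left.1 (h.disjoint_segment hl hlt hj') hx)
    · obtain ⟨-, hj | ⟨a, rfl⟩⟩ := hl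
      · omega
      obtain ⟨-, hj | ⟨b, rfl⟩⟩ := hl'
      · omega
      have hab : a ≠ b := by rintro rfl; exact hne rfl
      have hxj : x = stackPos par j := by
        rw [segment_symm, h.stackPos_eq hj'] at hx hx'
        rw [h.stackPos_eq hj']
        exact spoke_inter_spoke (h.nondegTriangle hj') hab hx hx'
      exact ⟨Or.inr hxj, Or.inr hxj⟩
  · exact base_segment_inter hl.1 (by omega) hl'.1 (by omega) hne hx hx'

/-- The straight line drawing of a stacked triangulation. -/
noncomputable def planeEmbedding (h : IsStacking par face) (n : ℕ) :
    PlaneEmbedding (stackGraphFin par n) where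
  vtx u := stackPos par u
  vtx_inj := h.stackPos_injective.comp Fin.val_injective
  arc u v _ := segment ℝ (stackPos par u) (stackPos par v)
  arc_symm _ _ _ := segment_symm ℝ _ _
  arc_path u v huv := by
    have hne : stackPos par u ≠ stackPos par v := h.stackPos_injective.ne
      fun e => huv.ne (Fin.ext e)
    refine ⟨⟨⟨fun s => AffineMap.lineMap (stackPos par u) (stackPos par v) (s : ℝ), by fun_prop⟩,
      by simp, by simp⟩, fun s s' e => Subtype.ext (AffineMap.lineMap_injective ℝ hne e), ?_⟩
    rw [segment_eq_image_lineMap, Set.image_eq_range]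
    rfl
  arc_vtx u v huv w hw := by
    rcases huv with hl | hl
    · exact (h.eq_of_stackPos_mem_segment hl hw).imp Fin.ext Fin.ext
    · rw [segment_symm] at hw
      exact (h.eq_of_stackPos_mem_segment hl hw).symm.imp Fin.ext Fin.ext
  arc_inter u v a b h₁ h₂ hne := by
    have hne₁ : ¬ (u = a ∧ v = b) := fun e => hne (by rw [e.1, e.2])
    have hne₂ : ¬ (u = b ∧ v = a) := fun e => hne (by rw [e.1, e.2, Sym2.eq_swap])
    rcases h₁ with h₁ | h₁ <;> rcases h₂ with h₂ | h₂
    · exact h.segment_inter_segment h₁ h₂ (by simp; omega)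
    · rw [segment_symm ℝ (stackPos par a), Set.pair_comm (stackPos par a)]
      exact h.segment_inter_segment h₁ h₂ (by simp; omega)
    · rw [segment_symm ℝ (stackPos par u), Set.pair_comm (stackPos par u)]
      exact h.segment_inter_segment h₁ h₂ (by simp; omega)
    · rw [segment_symm ℝ (stackPos par a), Set.pair_comm (stackPos par a),
        segment_symm ℝ (stackPos par u), Set.pair_comm (stackPos par u)]
      exact h.segment_inter_segment h₁ h₂ (by simp; omega)

theorem isPlaneTriangulation (h : IsStacking par face) (n : ℕ) :
    IsPlaneTriangulation (stackGraphFin par n) :=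
  ⟨⟨h.planeEmbedding n⟩, fun _ _ huv hna => h.not_isPlanar_sup_edge huv hna⟩

end IsStacking

/-! ### Clique minors and simplicial vertices -/

section CliqueModel

variable {V W : Type} {G : SimpleGraph V} {H : SimpleGraph W}

/-- `G` has a `K_m`-minor all of whose branch sets lie in `S`. -/
def HasCliqueMinorIn (G : SimpleGraph V) (S : Set V) (m : ℕ) : Prop :=
  ∃ B : Fin m → Set V,
    (∀ i, B i ⊆ S) ∧
    (∀ i, (B i).Nonempty) ∧
    (∀ i, (G.induce (B i)).Connected) ∧
    (∀ i j, i ≠ j → Disjoint (B i) (B j)) ∧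
    (∀ i j, i ≠ j → ∃ u ∈ B i, ∃ v ∈ B j, G.Adj u v)

theorem HasCliqueMinor.hasCliqueMinorIn {m : ℕ} (h : HasCliqueMinor H m) (f : H →g G)
    (hf : Function.Injective f) {S : Set V} (hS : ∀ x, f x ∈ S) : HasCliqueMinorIn G S m := by
  obtain ⟨B, hne, hconn, hdisj, hadj⟩ := h
  refine ⟨fun i => f '' B i, ?_, fun i => (hne i).image f, fun i => ?_, fun i j hij => ?_,
    fun i j hij => ?_⟩
  · rintro i _ ⟨x, -, rfl⟩
    exact hS x
  · let g : H.induce (B i) →g G.induce (f '' B i) :=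
      { toFun := fun x => ⟨f x.1, x.1, x.2, rfl⟩
        map_rel' := fun {_ _} hxy => f.map_adj hxy }
    refine (hconn i).map g ?_
    rintro ⟨_, x, hx, rfl⟩
    exact ⟨⟨x, hx⟩, rfl⟩
  · exact (Set.disjoint_image_iff hf).2 (hdisj i j hij)
  · obtain ⟨u, hu, v, hv, huv⟩ := hadj i j hij
    exact ⟨f u, ⟨u, hu, rfl⟩, f v, ⟨v, hv, rfl⟩, f.map_adj huv⟩

theorem reachable_map_of_adj {f : V → W}
    (hf : ∀ x y, G.Adj x y → H.Reachable (f x) (f y)) {x y : V} (h : G.Reachable x y) :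
    H.Reachable (f x) (f y) := by
  obtain ⟨p⟩ := h
  induction p with
  | nil => exact SimpleGraph.Reachable.refl _
  | cons hadj _ ih => exact (hf _ _ hadj).trans ih

/-- Deleting a vertex whose neighbours form a clique preserves connectedness. -/
theorem connected_induce_diff_singleton {B : Set V} {w n : V} (hB : (G.induce B).Connected)
    (hn : n ∈ B) (hwn : G.Adj w n)
    (hclique : ∀ x ∈ B, ∀ y ∈ B, G.Adj w x → G.Adj w y → x ≠ y → G.Adj x y) :
    (G.induce (B \ {w})).Connected := by
  classical
  have hnw : n ∈ B \ {w} := ⟨hn, hwn.ne'⟩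
  let f : B → ↑(B \ {w}) := fun x => if hx : x.1 = w then ⟨n, hnw⟩ else ⟨x.1, x.2, hx⟩
  have hf : ∀ x y, (G.induce B).Adj x y → (G.induce (B \ {w})).Reachable (f x) (f y) := by
    rintro ⟨x, hx⟩ ⟨y, hy⟩ hxy
    replace hxy : G.Adj x y := hxy
    simp only [f]
    split_ifs with hxw hyw hyw
    · exact SimpleGraph.Reachable.refl _
    · subst hxw
      by_cases hny : n = y
      · subst hny
        exact SimpleGraph.Reachable.refl _
      · exact SimpleGraph.Adj.reachable
          (show G.Adj n y from hclique n hn y hy hwn hxy hny)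
    · subst hyw
      by_cases hnx : n = x
      · subst hnx
        exact SimpleGraph.Reachable.refl _
      · exact SimpleGraph.Adj.reachable
          (show G.Adj x n from (hclique n hn x hx hwn hxy.symm hnx).symm)
    · exact SimpleGraph.Adj.reachable (show G.Adj x y from hxy)
  refine SimpleGraph.connected_iff_exists_forall_reachable _ |>.2 ⟨⟨n, hnw⟩, ?_⟩
  rintro ⟨y, hy⟩
  have := reachable_map_of_adj hf (hB.preconnected ⟨n, hn⟩ ⟨y, hy.1⟩)
  have hfn : f ⟨n, hn⟩ = ⟨n, hnw⟩ := dif_neg hwn.ne'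
  have hfy : f ⟨y, hy.1⟩ = ⟨y, hy⟩ := dif_neg hy.2
  rwa [hfn, hfy] at this

/-- A simplicial vertex of degree at most two is irrelevant for `K₄`-minors. -/
theorem HasCliqueMinorIn.diff_singleton {S : Set V} {w p q : V} (h : HasCliqueMinorIn G S 4)
    (hpq : ∀ x ∈ S, G.Adj w x → x = p ∨ x = q)
    (hclique : ∀ x ∈ S, ∀ y ∈ S, G.Adj w x → G.Adj w y → x ≠ y → G.Adj x y) :
    HasCliqueMinorIn G (S \ {w}) 4 := by
  obtain ⟨B, hS, hne, hconn, hdisj, hadj⟩ := h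
  have hnbr : ∀ i, w ∈ B i → ∃ n ∈ B i, G.Adj w n := by
    intro i hwi
    by_contra! hno
    have honly : ∀ x ∈ B i, x = w := by
      intro x hx
      by_contra hxw
      have hr := (hconn i).preconnected ⟨w, hwi⟩ ⟨x, hx⟩
      obtain ⟨walk⟩ := hr
      cases walk with
      | nil => exact hxw rfl
      | cons ha _ => exact hno _ (Subtype.prop _) ha
    have hout : ∀ j, j ≠ i → p ∈ B j ∨ q ∈ B j := by
      intro j hj
      obtain ⟨u, hu, v, hv, huv⟩ := hadj i j hj.symm
      rw [honly u hu] at huv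
      rcases hpq v (hS j hv) huv with rfl | rfl
      · exact Or.inl hv
      · exact Or.inr hv
    have huniq : ∀ x j k, x ∈ B j → x ∈ B k → j = k := by
      intro x j k hj hk
      by_contra hjk
      exact Set.disjoint_left.1 (hdisj j k hjk) hj hk
    have hthree : ∀ i : Fin 4, ∃ a b c : Fin 4,
        a ≠ i ∧ b ≠ i ∧ c ≠ i ∧ a ≠ b ∧ a ≠ c ∧ b ≠ c := by decide
    obtain ⟨a, b, c, ha, hb, hc, hab, hac, hbc⟩ := hthree i
    rcases hout a ha with h1 | h1 <;> rcases hout b hb with h2 | h2 <;>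
      rcases hout c hc with h3 | h3 <;>
      first
      | exact hab (huniq _ _ _ h1 h2)
      | exact hac (huniq _ _ _ h1 h3)
      | exact hbc (huniq _ _ _ h2 h3)
  have hreplace : ∀ i u, u ∈ B i → ∃ u' ∈ B i \ {w}, ∀ v ∈ S, v ∉ B i → G.Adj u v →
      G.Adj u' v := by
    intro i u hu
    by_cases huw : u = w
    · subst huw
      obtain ⟨n, hn, hwn⟩ := hnbr i hu
      refine ⟨n, ⟨hn, hwn.ne'⟩, fun v hv hvi huv => hclique n (hS i hn) v hv hwn huv ?_⟩
      rintro rfl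
      exact hvi hn
    · exact ⟨u, ⟨hu, huw⟩, fun _ _ _ huv => huv⟩
  refine ⟨fun i => B i \ {w}, fun i => Set.sdiff_subset_sdiff_left (hS i), fun i => ?_, fun i => ?_,
    fun i j hij => (hdisj i j hij).mono Set.sdiff_subset Set.sdiff_subset, fun i j hij => ?_⟩
  · obtain ⟨u, hu⟩ := hne i
    obtain ⟨u', hu', -⟩ := hreplace i u hu
    exact ⟨u', hu'⟩
  · by_cases hwi : w ∈ B i
    · obtain ⟨n, hn, hwn⟩ := hnbr i hwi
      exact connected_induce_diff_singleton (hconn i) hn hwn fun x hx y hy =>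
        hclique x (hS i hx) y (hS i hy)
    · have hBi : B i \ {w} = B i := Set.sdiff_singleton_eq_self hwi
      change (G.induce (B i \ {w})).Connected
      rw [hBi]
      exact hconn i
  · obtain ⟨u, hu, v, hv, huv⟩ := hadj i j hij
    have hd := Set.disjoint_left.1 (hdisj i j hij)
    obtain ⟨u', hu', hu'v⟩ := hreplace i u hu
    obtain ⟨v', hv', hv'u⟩ := hreplace j v hv
    refine ⟨u', hu', v', hv', ?_⟩
    have h1 := hu'v v (hS j hv) (fun e => hd e hv) huv
    exact (hv'u u' (hS i hu'.1) (hd hu'.1) h1.symm).symm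

theorem not_hasCliqueMinorIn_stackGraph {par : ℕ → Fin 3 → ℕ} {face : ℕ → ℕ × Fin 3}
    (h : IsStacking par face) {D : Set ℕ} (hD : ∀ i, 3 ≤ i → i ∉ D → ∃ a, par i a ∈ D) (k : ℕ) :
    ¬ HasCliqueMinorIn (stackGraph par) {m | m < k ∧ m ∉ D} 4 := by
  induction k with
  | zero =>
    rintro ⟨B, hS, hne, -⟩
    obtain ⟨u, hu⟩ := hne 0
    exact absurd (hS 0 hu).1 (Nat.not_lt_zero _)
  | succ k ih =>
    intro hmin
    have mono : ∀ {S T : Set ℕ}, S ⊆ T → HasCliqueMinorIn (stackGraph par) S 4 →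
        HasCliqueMinorIn (stackGraph par) T 4 := fun hST ⟨B, hB, hrest⟩ =>
      ⟨B, fun i => (hB i).trans hST, hrest⟩
    by_cases hk : k ∈ D
    · refine ih (mono ?_ hmin)
      rintro m ⟨hm, hmD⟩
      have : m ≠ k := by rintro rfl; exact hmD hk
      exact ⟨by omega, hmD⟩
    have hsub : {m | m < k + 1 ∧ m ∉ D} \ {k} ⊆ {m | m < k ∧ m ∉ D} := by
      rintro m ⟨⟨hm, hmD⟩, hmk⟩
      have : m ≠ k := hmk
      exact ⟨by omega, hmD⟩
    have hlink : ∀ x ∈ {m | m < k + 1 ∧ m ∉ D}, (stackGraph par).Adj k x →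
        StackLink par x k := by
      rintro x ⟨hx, -⟩ (hl | hl)
      · have := hl.1
        omega
      · exact hl
    by_cases hk3 : k < 3
    · refine ih (mono hsub (hmin.diff_singleton (w := k) (p := 0) (q := 1) ?_ ?_))
      · intro x hx hkx
        have := (hlink x hx hkx).1
        omega
      · intro x hx y hy hkx hky hxy
        have hxk := (hlink x hx hkx).1
        have hyk := (hlink y hy hky).1
        rcases hxy.lt_or_gt with hlt | hlt
        · exact Or.inl ⟨hlt, Or.inl (by omega)⟩
        · exact Or.inr ⟨hlt, Or.inl (by omega)⟩
    · push Not at hk3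
      have hpar : ∀ x ∈ {m | m < k + 1 ∧ m ∉ D}, (stackGraph par).Adj k x →
          ∃ a, par k a = x := fun x hx hkx => (hlink x hx hkx).2.resolve_left (by omega)
      obtain ⟨a, ha⟩ := hD k hk3 hk
      have hothers : ∀ a : Fin 3, ∃ b c, ∀ d, d ≠ a → d = b ∨ d = c := by decide
      obtain ⟨b, c, hbc⟩ := hothers a
      refine ih (mono hsub (hmin.diff_singleton (w := k) (p := par k b) (q := par k c) ?_ ?_))
      · intro x hx hkx
        obtain ⟨d, rfl⟩ := hpar x hx hkx
        have hda : d ≠ a := by rintro rfl; exact hx.2 ha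
        rcases hbc d hda with rfl | rfl
        · exact Or.inl rfl
        · exact Or.inr rfl
      · intro x hx y hy hkx hky hxy
        obtain ⟨d, rfl⟩ := hpar x hx hkx
        obtain ⟨e, rfl⟩ := hpar y hy hky
        exact h.par_adj_par hk3 fun hde => hxy (by rw [hde])

theorem k4MinorFree_induce_stackGraphFin {par : ℕ → Fin 3 → ℕ} {face : ℕ → ℕ × Fin 3}
    (h : IsStacking par face) {D : Set ℕ} (hD : ∀ i, 3 ≤ i → i ∉ D → ∃ a, par i a ∈ D)
    {n : ℕ} {S : Set (Fin n)} (hS : ∀ x ∈ S, x.val ∉ D) :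
    K4MinorFree ((stackGraphFin par n).induce S) := by
  intro hmin
  let f : (stackGraphFin par n).induce S →g stackGraph par :=
    { toFun := fun x => x.1.val
      map_rel' := fun {_ _} hxy => hxy }
  exact not_hasCliqueMinorIn_stackGraph h hD n <| hmin.hasCliqueMinorIn f
    (Fin.val_injective.comp Subtype.val_injective) fun x => ⟨x.1.2, hS x.1 x.2⟩

end CliqueModel

/-! ### A stacked triangulation built from gadgets -/

/-- The triangles of the nineteen vertices of a gadget. Codes `0` and `1` are the two apices
common to all gadgets, code `2` is the attaching vertex, and `r + 3` is the vertex `r` of the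
gadget. -/
def gadgetPar : Fin 19 → Fin 3 → ℕ :=
  ![![0, 1, 2], ![0, 1, 3], ![0, 4, 3], ![5, 4, 3], ![6, 4, 3], ![7, 4, 3], ![8, 4, 3],
    ![6, 4, 7], ![8, 4, 9], ![5, 6, 3], ![5, 4, 6], ![6, 4, 10], ![6, 10, 7], ![6, 7, 3],
    ![7, 8, 3], ![7, 4, 8], ![8, 4, 11], ![8, 11, 9], ![8, 9, 3]]

/-- The face of the gadget that is subdivided by each vertex. -/
def gadgetFace : Fin 19 → ℕ × Fin 3 :=
  ![(2, 2), (3, 2), (4, 1), (5, 0), (6, 0), (7, 0), (8, 0), (7, 2), (9, 2), (6, 1), (6, 2),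
    (10, 2), (10, 1), (7, 1), (8, 1), (8, 2), (11, 2), (11, 1), (9, 1)]

/-- The vertex with code `c` in the gadget `k`. -/
def gadgetVertex (k c : ℕ) : ℕ :=
  if c < 2 then c else if c = 2 then (if k = 0 then 2 else 19 * k - 15) else 19 * k + c

/-- The position of a vertex in its gadget. -/
def gadgetIndex (i : ℕ) : Fin 19 := ⟨(i - 3) % 19, Nat.mod_lt _ (by norm_num)⟩

/-- The triangles of the chain of gadgets. -/
def chainPar (i : ℕ) (a : Fin 3) : ℕ := gadgetVertex ((i - 3) / 19) (gadgetPar (gadgetIndex i) a)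

/-- The subdivided faces of the chain of gadgets. -/
def chainFace (i : ℕ) : ℕ × Fin 3 :=
  (gadgetVertex ((i - 3) / 19) (gadgetFace (gadgetIndex i)).1, (gadgetFace (gadgetIndex i)).2)

theorem gadgetVertex_two_succ (k : ℕ) : gadgetVertex (k + 1) 2 = 19 * k + 3 + (1 : Fin 19) := by
  simp [gadgetVertex]
  omega

theorem gadgetVertex_of_three_le {c : ℕ} (k : ℕ) (hc : 3 ≤ c) : gadgetVertex k c = 19 * k + c := by
  rw [gadgetVertex, if_neg (by omega), if_neg (by omega)]

theorem exists_gadget {i : ℕ} (hi : 3 ≤ i) : ∃ (k : ℕ) (r : Fin 19), i = 19 * k + 3 + r :=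
  ⟨(i - 3) / 19, gadgetIndex i, by simp only [gadgetIndex]; omega⟩

theorem chainPar_eq (k : ℕ) (r : Fin 19) (a : Fin 3) :
    chainPar (19 * k + 3 + r) a = gadgetVertex k (gadgetPar r a) := by
  have h1 : (19 * k + 3 + r.val - 3) / 19 = k := by omega
  have h2 : gadgetIndex (19 * k + 3 + r) = r := by
    ext
    simp only [gadgetIndex]
    omega
  rw [chainPar, h1, h2]

theorem chainFace_eq (k : ℕ) (r : Fin 19) :
    chainFace (19 * k + 3 + r) = (gadgetVertex k (gadgetFace r).1, (gadgetFace r).2) := by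
  have h1 : (19 * k + 3 + r.val - 3) / 19 = k := by omega
  have h2 : gadgetIndex (19 * k + 3 + r) = r := by
    ext
    simp only [gadgetIndex]
    omega
  rw [chainFace, h1, h2]

theorem gadgetFace_bounds : ∀ r : Fin 19, r ≠ 0 →
    3 ≤ (gadgetFace r).1 ∧ (gadgetFace r).1 < r + 3 := by decide

theorem gadgetFace_injective : Function.Injective gadgetFace := by decide

theorem gadgetFace_ne : ∀ r : Fin 19, gadgetFace r ≠ (4, 2) := by decide

theorem gadgetPar_eq : ∀ r : Fin 19, r ≠ 0 → ∀ s : Fin 19, (gadgetFace r).1 = s + 3 →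
    ∀ a, gadgetPar r a = Function.update (gadgetPar s) (gadgetFace r).2 (s + 3) a := by decide

/-- Away from the first vertex, the subdivided face belongs to a vertex of the chain, and every
such face is subdivided once. -/
theorem chainFace_cases {i : ℕ} (hi : 3 < i) :
    (∃ k, i = 19 * (k + 1) + 3 ∧ chainFace i = (19 * k + 4, 2)) ∨
      ∃ k, ∃ r : Fin 19, r ≠ 0 ∧ i = 19 * k + 3 + r ∧
        chainFace i = (19 * k + (gadgetFace r).1, (gadgetFace r).2) := by
  obtain ⟨k, r, rfl⟩ := exists_gadget hi.le
  rw [chainFace_eq]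
  by_cases hr : r = 0
  · subst hr
    obtain ⟨k, rfl⟩ : ∃ l, k = l + 1 := ⟨k - 1, by simp at hi; omega⟩
    exact Or.inl ⟨k, by simp, Prod.ext (gadgetVertex_two_succ k) rfl⟩
  · exact Or.inr ⟨k, r, hr, rfl, by
      rw [gadgetVertex_of_three_le k (gadgetFace_bounds r hr).1]⟩

theorem isStacking_chain : IsStacking chainPar chainFace where
  root := by
    funext a
    fin_cases a <;> rfl
  le_face i hi := by
    rcases chainFace_cases hi with ⟨k, rfl, h⟩ | ⟨k, r, hr, rfl, h⟩
    · rw [h]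
      show 3 ≤ 19 * k + 4
      omega
    · rw [h]
      have := (gadgetFace_bounds r hr).1
      show 3 ≤ 19 * k + (gadgetFace r).1
      omega
  face_lt i hi := by
    rcases chainFace_cases hi with ⟨k, rfl, h⟩ | ⟨k, r, hr, rfl, h⟩
    · rw [h]
      show 19 * k + 4 < _
      omega
    · rw [h]
      have := (gadgetFace_bounds r hr).2
      show 19 * k + (gadgetFace r).1 < _
      omega
  par_eq i hi := by
    funext a
    rcases chainFace_cases hi with ⟨k, rfl, h⟩ | ⟨k, r, hr, rfl, h⟩
    · have h1 := chainPar_eq (k + 1) 0 a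
      have h2 := chainPar_eq k 1
      have h3 : 19 * k + 4 = 19 * k + 3 + (1 : Fin 19) := by simp
      simp only [h, Function.update_apply]
      rw [h3, h2]
      simp only [Fin.val_zero, add_zero] at h1
      rw [h1]
      fin_cases a
      · rfl
      · rfl
      · exact gadgetVertex_two_succ k
    · obtain ⟨hge, hlt⟩ := gadgetFace_bounds r hr
      let s : Fin 19 := ⟨(gadgetFace r).1 - 3, by omega⟩
      have hs : (gadgetFace r).1 = s + 3 := by simp only [s]; omega
      have h3 : 19 * k + (gadgetFace r).1 = 19 * k + 3 + s := by omega
      have h4 := gadgetPar_eq r hr s hs a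
      simp only [h, Function.update_apply] at h4 ⊢
      rw [h3, chainPar_eq, chainPar_eq, h4]
      split_ifs
      · rw [gadgetVertex_of_three_le k (by omega)]
        omega
      · rfl
  face_inj i j hi hj hij := by
    rcases chainFace_cases hi with ⟨k, rfl, h⟩ | ⟨k, r, hr, rfl, h⟩ <;>
      rcases chainFace_cases hj with ⟨l, rfl, h'⟩ | ⟨l, s, hs, rfl, h'⟩ <;>
      rw [h, h', Prod.mk.injEq] at hij
    · omega
    · obtain ⟨hge, hlt⟩ := gadgetFace_bounds s hs
      exact absurd (Prod.ext (by show _ = 4; omega) hij.2.symm) (gadgetFace_ne s)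
    · obtain ⟨hge, hlt⟩ := gadgetFace_bounds r hr
      exact absurd (Prod.ext (by show _ = 4; omega) hij.2) (gadgetFace_ne r)
    · obtain ⟨hge, hlt⟩ := gadgetFace_bounds r hr
      obtain ⟨hge', hlt'⟩ := gadgetFace_bounds s hs
      have hk : k = l := by omega
      have hrs : r = s := gadgetFace_injective (Prod.ext (by omega) hij.2)
      rw [hk, hrs]

/-- The vertex `r` of the gadget `k`, among the vertices of the first `K` gadgets. -/
def chainVertex (K : ℕ) (k : Fin K) (r : Fin 19) : Fin (3 + 19 * K) :=
  ⟨19 * k + 3 + r, by omega⟩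

theorem chainVertex_injective (K : ℕ) :
    Function.Injective fun x : Fin K × Fin 19 => chainVertex K x.1 x.2 := by
  rintro ⟨k, r⟩ ⟨l, s⟩ h
  have := congrArg Fin.val h
  simp only [chainVertex] at this
  ext <;> simp <;> omega

theorem chainVertex_adj {K : ℕ} (k : Fin K) {r s : Fin 19} {a : Fin 3}
    (h : gadgetPar r a = s + 3) :
    (stackGraphFin chainPar (3 + 19 * K)).Adj (chainVertex K k r) (chainVertex K k s) := by
  have hl := isStacking_chain.link_par (i := 19 * k + 3 + r) (by omega) a
  rw [chainPar_eq, h, gadgetVertex_of_three_le _ (by omega), ← add_assoc, add_right_comm] at hl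
  exact Or.inr hl

section InducedSubgraphs

variable {K : ℕ}

/-- Five vertices of a gadget inducing a supergraph of `K_{2,3}`, the two sides alternating. -/
def gadgetK23 : Fin 5 → Fin 19 := ![2, 0, 4, 1, 6]

/-- Quadruples of vertices of a gadget that induce complete graphs. -/
def gadgetK4 (t : Fin 10) : Fin 4 → Fin 19 :=
  let r : Fin 19 := ⟨t + 9, by omega⟩
  Fin.cons r fun a => ⟨(gadgetPar r a - 3) % 19, Nat.mod_lt _ (by norm_num)⟩

theorem gadgetK23_link : ∀ i j : Fin 5, i.val % 2 = 0 → j.val % 2 = 1 →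
    ∃ a, gadgetPar (gadgetK23 i) a = gadgetK23 j + 3 := by decide

theorem gadgetK4_link : ∀ (t : Fin 10) (i j : Fin 4), i < j →
    (∃ a, gadgetPar (gadgetK4 t i) a = gadgetK4 t j + 3) ∨
      ∃ a, gadgetPar (gadgetK4 t j) a = gadgetK4 t i + 3 := by decide

set_option maxRecDepth 10000 in
/-- No two vertices of a gadget meet all the obstructions to outerplanarity. -/
theorem gadget_transversal : ∀ d e : Fin 19,
    (∀ i, gadgetK23 i ≠ d ∧ gadgetK23 i ≠ e) ∨ ∃ t, ∀ i, gadgetK4 t i ≠ d ∧ gadgetK4 t i ≠ e := by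
  decide

/-- An induced outerplanar subgraph misses at least three vertices of every gadget. -/
theorem three_le_card_missing {S : Finset (Fin (3 + 19 * K))}
    (hS : IsOuterplanar ((stackGraphFin chainPar (3 + 19 * K)).induce (S : Set _))) (k : Fin K) :
    3 ≤ (Finset.univ.filter fun r => chainVertex K k r ∉ S).card := by
  by_contra! hcard
  obtain ⟨T, hT, hTcard⟩ := Finset.exists_superset_card_eq (Nat.le_of_lt_succ hcard)
    (by simp : 2 ≤ Fintype.card (Fin 19))
  obtain ⟨d, e, -, rfl⟩ := Finset.card_eq_two.1 hTcard
  have hmem : ∀ r, r ≠ d ∧ r ≠ e → chainVertex K k r ∈ (S : Set _) := by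
    intro r hr
    by_contra hrS
    have := hT (Finset.mem_filter.2 ⟨Finset.mem_univ r, hrS⟩)
    simp [hr.1, hr.2] at this
  have hinj : Function.Injective (chainVertex K k) := fun r s hrs =>
    (Prod.mk.inj (@chainVertex_injective K (k, r) (k, s) hrs)).2
  rcases gadget_transversal d e with h | ⟨t, h⟩
  · refine not_isOuterplanar_of_K23 (fun i => ⟨chainVertex K k (gadgetK23 i), hmem _ (h i)⟩) ?_ ?_
      hS
    · intro i j hij
      have hK : Function.Injective gadgetK23 := by decide
      exact hK (hinj (congrArg Subtype.val hij))
    · intro i j hi hj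
      obtain ⟨a, ha⟩ := gadgetK23_link i j hi hj
      exact chainVertex_adj k ha
  · refine not_isOuterplanar_of_K4 (fun i => ⟨chainVertex K k (gadgetK4 t i), hmem _ (h i)⟩) ?_ hS
    intro i j hij
    rcases gadgetK4_link t i j hij with ⟨a, ha⟩ | ⟨a, ha⟩
    · exact chainVertex_adj k ha
    · exact (chainVertex_adj k ha).symm

theorem card_add_le_of_isOuterplanar {S : Finset (Fin (3 + 19 * K))}
    (hS : IsOuterplanar ((stackGraphFin chainPar (3 + 19 * K)).induce (S : Set _))) :
    S.card + 3 * K ≤ 3 + 19 * K := by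
  let T := Finset.univ.sigma fun k : Fin K =>
    Finset.univ.filter fun r => chainVertex K k r ∉ S
  have hT : 3 * K ≤ T.card := by
    rw [Finset.card_sigma]
    calc 3 * K = ∑ _k : Fin K, 3 := by simp [mul_comm]
      _ ≤ _ := Finset.sum_le_sum fun k _ => three_le_card_missing hS k
  have hTS : T.card ≤ Sᶜ.card := by
    refine Finset.card_le_card_of_injOn (fun x => chainVertex K x.1 x.2) ?_ ?_
    · rintro ⟨k, r⟩ hx
      simpa [T] using hx
    · rintro ⟨k, r⟩ - ⟨l, s⟩ - h
      have := @chainVertex_injective K (k, r) (l, s) h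
      simp only [Prod.mk.injEq] at this
      rw [this.1, this.2]
  have := Finset.card_add_card_compl S
  rw [Fintype.card_fin] at this
  omega

theorem sO_chain_le : sO (stackGraphFin chainPar (3 + 19 * K)) ≤ 3 + 16 * K := by
  refine csSup_le' ?_
  rintro _ ⟨S, hS, rfl⟩
  have := card_add_le_of_isOuterplanar hS
  omega

/-- The vertices whose deletion leaves a `K₄`-minor-free graph. -/
def chainDeleted : Set ℕ := {i | i < 2 ∨ i % 19 = 6 ∨ i % 19 = 8}

theorem gadgetPar_deleted : ∀ r : Fin 19, r = 3 ∨ r = 5 ∨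
    ∃ a, gadgetPar r a = 0 ∨ gadgetPar r a = 1 ∨ gadgetPar r a = 6 ∨ gadgetPar r a = 8 := by
  decide

theorem exists_chainPar_mem_deleted (i : ℕ) (hi : 3 ≤ i) (hiD : i ∉ chainDeleted) :
    ∃ a, chainPar i a ∈ chainDeleted := by
  obtain ⟨k, r, rfl⟩ := exists_gadget hi
  rcases gadgetPar_deleted r with rfl | rfl | ⟨a, ha⟩
  · exact absurd (Or.inr (Or.inl (by simp; omega))) hiD
  · exact absurd (Or.inr (Or.inr (by simp; omega))) hiD
  · refine ⟨a, ?_⟩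
    rw [chainPar_eq]
    rcases ha with ha | ha | ha | ha <;> rw [ha] <;> simp [gadgetVertex, chainDeleted]

theorem le_sK4_chain : 1 + 17 * K ≤ sK4 (stackGraphFin chainPar (3 + 19 * K)) := by
  classical
  let D : Finset (Fin (3 + 19 * K)) := Finset.univ.filter fun i => i.val ∈ chainDeleted
  have hD : D.card ≤ 2 + 2 * K := by
    have hsub : D.image Fin.val ⊆ Finset.range 2 ∪
        ((Finset.range K).image (fun k => 19 * k + 6) ∪
          (Finset.range K).image fun k => 19 * k + 8) := by
      intro i hi
      obtain ⟨j, hj, rfl⟩ := Finset.mem_image.1 hi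
      have hlt := j.2
      simp only [Finset.mem_union, Finset.mem_range, Finset.mem_image]
      rcases (Finset.mem_filter.1 hj).2 with h | h | h
      · exact Or.inl h
      · exact Or.inr (Or.inl ⟨j.val / 19, by omega, by omega⟩)
      · exact Or.inr (Or.inr ⟨j.val / 19, by omega, by omega⟩)
    rw [← Finset.card_image_of_injective D Fin.val_injective]
    refine (Finset.card_le_card hsub).trans ((Finset.card_union_le _ _).trans ?_)
    have h1 := Finset.card_union_le ((Finset.range K).image (fun k => 19 * k + 6))
      ((Finset.range K).image fun k => 19 * k + 8)
    have h2 := Finset.card_image_le (s := Finset.range K) (f := fun k => 19 * k + 6)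
    have h3 := Finset.card_image_le (s := Finset.range K) (f := fun k => 19 * k + 8)
    rw [Finset.card_range] at h2 h3 ⊢
    omega
  have hcard := Finset.card_add_card_compl D
  rw [Fintype.card_fin] at hcard
  have hbdd : BddAbove {n | ∃ S : Finset (Fin (3 + 19 * K)),
      K4MinorFree ((stackGraphFin chainPar (3 + 19 * K)).induce (S : Set _)) ∧ S.card = n} := by
    refine ⟨Fintype.card (Fin (3 + 19 * K)), ?_⟩
    rintro _ ⟨S, -, rfl⟩
    exact S.card_le_univ
  refine le_trans ?_ (le_csSup hbdd ⟨Dᶜ, k4MinorFree_induce_stackGraphFin isStacking_chain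
    exists_chainPar_mem_deleted fun x hx => ?_, rfl⟩)
  · omega
  · simpa [D] using hx

end InducedSubgraphs

/-- For every real `M` there exists a plane triangulation `G` with
`s_{K₄}(G) − s_o(G) > M`. -/
theorem stmt4 (M : ℝ) :
    ∃ (V : Type) (inst : Fintype V) (G : SimpleGraph V) (_ : PlaneEmbedding G),
      IsPlaneTriangulation G ∧ M < ((@sK4 V inst G : ℝ) - (@sO V inst G : ℝ)) := by
  obtain ⟨K, hK⟩ := exists_nat_gt (M + 2)
  refine ⟨Fin (3 + 19 * K), inferInstance, stackGraphFin chainPar (3 + 19 * K),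
    isStacking_chain.planeEmbedding _, isStacking_chain.isPlaneTriangulation _, ?_⟩
  have h1 : ((1 + 17 * K : ℕ) : ℝ) ≤ sK4 (stackGraphFin chainPar (3 + 19 * K)) :=
    Nat.cast_le.2 le_sK4_chain
  have h2 : (sO (stackGraphFin chainPar (3 + 19 * K)) : ℝ) ≤ (3 + 16 * K : ℕ) :=
    Nat.cast_le.2 sO_chain_le
  push_cast at h1 h2
  linarith
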